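/- There exists an absolute constant C > 0 with the following property. Let F be a field; if F has positive characteristic p > 0, let A ⊆ F² be a finite set with |A| ≤ p^{4/3} (no cardinality assumption if char F = 0). Let M denote the maximum number of points of A lying on a common line or on a common circle. Then the modified bisector energy satisfies B*(A) ≤ C·( M|A|² + Σ_{r ∈ F, r ≠ 0} |S_r(A)|^{3/2} ). -/

import Mathlib

namespace Stmt7

/-- The (algebraic) squared distance in the plane `F²`. -/
def dist2 {F : Type*} [CommRing F] (x y : F × F) : F :=
  (x.1 - y.1) ^ 2 + (x.2 - y.2) ^ 2

/-- The dot product on `F²`. -/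
def dot {F : Type*} [CommRing F] (x y : F × F) : F :=
  x.1 * y.1 + x.2 * y.2

/-- A line in `F²`. -/
def IsLine {F : Type*} [CommRing F] (L : Set (F × F)) : Prop :=
  ∃ x v : F × F, v ≠ 0 ∧ L = {y | ∃ t : F, y = x + t • v}

/-- A circle in `F²`: centre `c`, radius `r ≠ 0`. -/
def IsCircle {F : Type*} [CommRing F] (S : Set (F × F)) : Prop :=
  ∃ (c : F × F) (r : F), r ≠ 0 ∧ S = {x | dist2 x c = r}

/-- The perpendicular bisector `B(a,b) = {x | d(a,x) = d(b,x)}`. -/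
def bisector {F : Type*} [CommRing F] (a b : F × F) : Set (F × F) :=
  {x | dist2 a x = dist2 b x}

/-- `b*_A(ℓ)`: the number of pairs `(b,c) ∈ A²`, `b ≠ c`, with `(b-c)·(b-c) ≠ 0` and
perpendicular bisector equal to `ℓ`. -/
noncomputable def bstarL {F : Type*} [CommRing F] (A : Finset (F × F)) (ℓ : Set (F × F)) : ℕ :=
  Set.ncard {q : (F × F) × (F × F) |
    q.1 ∈ A ∧ q.2 ∈ A ∧ q.1 ≠ q.2 ∧
    dot (q.1 - q.2) (q.1 - q.2) ≠ 0 ∧ bisector q.1 q.2 = ℓ}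

/-- The modified bisector energy `B*(A) = Σ_ℓ b*_A(ℓ)²`, summed over all lines `ℓ`. -/
noncomputable def Bstar {F : Type*} [CommRing F] (A : Finset (F × F)) : ℕ :=
  ∑ᶠ ℓ ∈ {L : Set (F × F) | IsLine L}, (bstarL A ℓ) ^ 2

/-- `S_r(A)`: ordered pairs of distinct points of `A` at distance `r`. -/
def Sr {F : Type*} [CommRing F] (A : Finset (F × F)) (r : F) : Set ((F × F) × (F × F)) :=
  {q | q.1 ∈ A ∧ q.2 ∈ A ∧ q.1 ≠ q.2 ∧ dist2 q.1 q.2 = r}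

section Polynomials

open Polynomial

lemma natDegree_eq_of_derivative_mul_eq {E : Type*} [Field E] {f g : E[X]} {n : ℕ}
    (hn : ∀ j : ℕ, 0 < j → j ≤ n → (j : E) ≠ 0) (hf : f.natDegree ≤ n) (hg : g.natDegree ≤ n)
    (hf0 : f ≠ 0) (hg0 : g ≠ 0) (h : derivative f * g = f * derivative g) :
    f.natDegree = g.natDegree := by
  have hX : ∀ u : E[X], (X * derivative u).natDegree ≤ u.natDegree := by
    intro u
    by_cases hu : u.natDegree = 0
    · rw [eq_C_of_natDegree_eq_zero hu]; simp
    · have h1 := natDegree_mul_le (p := X) (q := derivative u)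
      have h2 := natDegree_derivative_le u
      have h3 : (X : E[X]).natDegree ≤ 1 := natDegree_X_le
      omega
  have hc : ∀ u : E[X], (X * derivative u).coeff u.natDegree = u.natDegree * u.leadingCoeff := by
    intro u
    rcases Nat.eq_zero_or_pos u.natDegree with hu | hu
    · rw [hu]; simp
    · obtain ⟨k, hk⟩ := Nat.exists_eq_succ_of_ne_zero hu.ne'
      rw [leadingCoeff, hk, coeff_X_mul, coeff_derivative]
      push_cast; ring
  have key : X * derivative f * g = f * (X * derivative g) := by
    linear_combination X * h
  have h1 := coeff_mul_add_eq_of_natDegree_le (hX f) (le_refl g.natDegree)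
  have h2 := coeff_mul_add_eq_of_natDegree_le (le_refl f.natDegree) (hX g)
  rw [key, h2, hc, hc] at h1
  have hlf : f.leadingCoeff ≠ 0 := leadingCoeff_ne_zero.2 hf0
  have hlg : g.leadingCoeff ≠ 0 := leadingCoeff_ne_zero.2 hg0
  rw [coeff_natDegree, coeff_natDegree] at h1
  have h3 : (g.natDegree : E) = f.natDegree := by
    apply mul_left_cancel₀ (mul_ne_zero hlf hlg)
    linear_combination h1
  rcases lt_trichotomy f.natDegree g.natDegree with hlt | heq | hlt
  · exfalso
    apply hn (g.natDegree - f.natDegree) (by omega) (by omega)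
    rw [Nat.cast_sub hlt.le, h3, sub_self]
  · exact heq
  · exfalso
    apply hn (f.natDegree - g.natDegree) (by omega) (by omega)
    rw [Nat.cast_sub hlt.le, h3, sub_self]

/-- Two polynomials of small degree with vanishing Wronskian are proportional. -/
lemma exists_eq_C_mul_of_derivative_mul_eq {E : Type*} [Field E] {f g : E[X]} {n : ℕ}
    (hn : ∀ j : ℕ, 0 < j → j ≤ n → (j : E) ≠ 0) (hf : f.natDegree ≤ n) (hg : g.natDegree ≤ n)
    (hg0 : g ≠ 0) (h : derivative f * g = f * derivative g) :
    ∃ κ : E, f = C κ * g := by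
  by_cases hf0 : f = 0
  · exact ⟨0, by simp [hf0]⟩
  have hd := natDegree_eq_of_derivative_mul_eq hn hf hg hf0 hg0 h
  have hlg : g.leadingCoeff ≠ 0 := leadingCoeff_ne_zero.2 hg0
  refine ⟨f.leadingCoeff / g.leadingCoeff, ?_⟩
  set κ := f.leadingCoeff / g.leadingCoeff with hκ
  by_contra hne
  have hu0 : f - C κ * g ≠ 0 := sub_ne_zero.2 hne
  have hcoeff : (f - C κ * g).coeff g.natDegree = 0 := by
    rw [coeff_sub, coeff_C_mul, coeff_natDegree, ← hd, coeff_natDegree, hκ]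
    field_simp
    ring
  have hle : (f - C κ * g).natDegree ≤ g.natDegree :=
    (natDegree_sub_le_of_le hd.le (natDegree_C_mul_le κ g)).trans (by simp)
  have heq := natDegree_eq_of_derivative_mul_eq (f := f - C κ * g) hn (hle.trans hg) hg hu0 hg0
    (by simp only [derivative_sub, derivative_C_mul]; linear_combination h)
  rw [← heq, coeff_natDegree, leadingCoeff_eq_zero] at hcoeff
  exact hu0 hcoeff

/-- If the second derivative of `β / h` vanishes then `β / h` is affine. -/
lemma exists_affine_mul_of_second_order {E : Type*} [Field E] {β h : E[X]} {n : ℕ}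
    (hn : ∀ j : ℕ, 0 < j → j ≤ 2 * n → (j : E) ≠ 0) (hβ : β.natDegree ≤ n) (hh : h.natDegree ≤ n)
    (hh0 : h ≠ 0)
    (hT : (derivative (derivative β) * h - β * derivative (derivative h)) * h
      - 2 * derivative h * (derivative β * h - β * derivative h) = 0) :
    ∃ κ₁ κ₀ : E, β = (C κ₁ * X + C κ₀) * h := by
  have hW : (derivative β * h - β * derivative h).natDegree ≤ 2 * n := by
    have d1 := natDegree_derivative_le β
    have d2 := natDegree_derivative_le h
    exact (natDegree_sub_le_of_le
      (natDegree_mul_le_of_le (d1.trans (Nat.sub_le _ _)) le_rfl)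
      (natDegree_mul_le_of_le le_rfl (d2.trans (Nat.sub_le _ _)))).trans (by omega)
  have hh2 : (h * h).natDegree ≤ 2 * n := natDegree_mul_le.trans (by omega)
  obtain ⟨κ, hκ⟩ := exists_eq_C_mul_of_derivative_mul_eq hn hW hh2 (mul_ne_zero hh0 hh0) (by
    simp only [derivative_sub, derivative_mul]
    linear_combination h * hT)
  by_cases hn0 : n = 0
  · have h1 : derivative β = 0 := by
      rw [eq_C_of_natDegree_eq_zero (p := β) (by omega)]; simp
    have h2 : derivative h = 0 := by
      rw [eq_C_of_natDegree_eq_zero (p := h) (by omega)]; simp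
    obtain ⟨κ', hκ'⟩ := exists_eq_C_mul_of_derivative_mul_eq (n := n) (f := β) (g := h)
      (fun j h1 h2 => hn j h1 (by omega)) hβ hh hh0 (by rw [h1, h2]; simp)
    exact ⟨0, κ', by rw [hκ']; simp⟩
  · obtain ⟨κ', hκ'⟩ := exists_eq_C_mul_of_derivative_mul_eq (f := β - C κ * X * h) (g := h) hn
      (by
        exact (natDegree_sub_le_of_le hβ
          (natDegree_mul_le_of_le ((natDegree_C_mul_le κ X).trans natDegree_X_le) hh)).trans
          (by omega))
      (hh.trans (by omega)) hh0
      (by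
        simp only [derivative_sub, derivative_mul, derivative_C, derivative_X]
        linear_combination hκ)
    exact ⟨κ, κ', by linear_combination hκ'⟩

end Polynomials

section Jets

/-- The third-order identity at a point of a surface where two null lines meet. -/
lemma second_order_eq_zero_of_jets {E : Type*} [Field E]
    {t s x y z xx xy xz yy yz zz xxx xxy xxz xyy xyz xzz yyy yyz yzz zzz : E}
    (hts : t ≠ s)
    (h1 : x + t * y + t ^ 2 * z = 0) (h2 : x + s * y + s ^ 2 * z = 0)
    (h11 : (xx + t * xy + t ^ 2 * xz) + t * (xy + t * yy + t ^ 2 * yz)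
      + t ^ 2 * (xz + t * yz + t ^ 2 * zz) = 0)
    (h22 : (xx + s * xy + s ^ 2 * xz) + s * (xy + s * yy + s ^ 2 * yz)
      + s ^ 2 * (xz + s * yz + s ^ 2 * zz) = 0)
    (h111 : xxx + 3 * t * xxy + 3 * t ^ 2 * (xxz + xyy) + t ^ 3 * (6 * xyz + yyy)
      + 3 * t ^ 4 * (xzz + yyz) + 3 * t ^ 5 * yzz + t ^ 6 * zzz = 0)
    {A B A' B' : E} (hA : A = -(y + s * z)) (hB : B = z)
    (hA' : A' = -((xy + s * yy + s ^ 2 * yz) + s * (xz + s * yz + s ^ 2 * zz)))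
    (hB' : B' = xz + s * yz + s ^ 2 * zz)
    (hU : 4 * B ^ 3 * B' * xx + B ^ 4 * (xxx + s * xxy + s ^ 2 * xxz)
      + 2 * (A' * B ^ 3 + 3 * A * B ^ 2 * B') * xy
      + 2 * A * B ^ 3 * (xxy + s * xyy + s ^ 2 * xyz)
      + (2 * A * A' * B ^ 2 + 2 * A ^ 2 * B * B') * (2 * xz + yy)
      + A ^ 2 * B ^ 2 * (2 * (xxz + s * xyz + s ^ 2 * xzz) + (xyy + s * yyy + s ^ 2 * yyz))
      + 2 * (3 * A ^ 2 * A' * B + A ^ 3 * B') * yz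
      + 2 * A ^ 3 * B * (xyz + s * yyz + s ^ 2 * yzz)
      + 4 * A ^ 3 * A' * zz + A ^ 4 * (xzz + s * yzz + s ^ 2 * zzz) = 0)
    {h β h' β' h'' β'' : E} (hh : h = y + 2 * t * z) (hβ : β = z)
    (hh' : h' = (xy + t * yy + t ^ 2 * yz) + 2 * t * (xz + t * yz + t ^ 2 * zz))
    (hβ' : β' = xz + t * yz + t ^ 2 * zz)
    (hh'' : h'' = (xxy + 2 * t * xyy + 2 * t ^ 2 * xyz + t ^ 2 * yyy + 2 * t ^ 3 * yyz
        + t ^ 4 * yzz)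
      + 2 * t * (xxz + 2 * t * xyz + 2 * t ^ 2 * xzz + t ^ 2 * yyz + 2 * t ^ 3 * yzz
        + t ^ 4 * zzz))
    (hβ'' : β'' = xxz + 2 * t * xyz + 2 * t ^ 2 * xzz + t ^ 2 * yyz + 2 * t ^ 3 * yzz
        + t ^ 4 * zzz) :
    (β'' * h - β * h'') * h - 2 * h' * (β' * h - β * h') = 0 := by
  have hδ : s - t ≠ 0 := sub_ne_zero.2 hts.symm
  have hy : y = -(t + s) * z := by
    apply mul_left_cancel₀ hδ; linear_combination h2 - h1
  have hhz : h = -(s - t) * β := by rw [hh, hβ, hy]; ring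
  by_cases hz : z = 0
  · have : β = 0 := hβ.trans hz
    rw [hhz, this]; ring
  obtain ⟨e, he⟩ : ∃ e, e = xx + (t + s) * xy + (t ^ 2 + s ^ 2) * xz + t * s * yy
    + (t * s ^ 2 + s * t ^ 2) * yz + t ^ 2 * s ^ 2 * zz := ⟨_, rfl⟩
  obtain ⟨w, hw⟩ : ∃ w, w = (xxx + s * xxy + s ^ 2 * xxz) + 2 * t * (xxy + s * xyy + s ^ 2 * xyz)
    + t ^ 2 * (2 * (xxz + s * xyz + s ^ 2 * xzz) + (xyy + s * yyy + s ^ 2 * yyz))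
    + 2 * t ^ 3 * (xyz + s * yyz + s ^ 2 * yzz) + t ^ 4 * (xzz + s * yzz + s ^ 2 * zzz) :=
    ⟨_, rfl⟩
  have e1 : (s - t) * h' = e - (s - t) ^ 2 * β' := by
    rw [hh', hβ', he]; linear_combination -h11
  have e2 : (s - t) * h'' = w - (s - t) ^ 2 * β'' := by
    rw [hh'', hβ'', hw]; linear_combination -h111
  have eA : A = t * β := by rw [hA, hβ, hy]; ring
  have eB : B = β := hB.trans hβ.symm
  have eA' : (s - t) * (A' - t * B') = e := by
    rw [hA', hB', he]; linear_combination -h22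
  have eU : β ^ 4 * w + 2 * β ^ 3 * h' * (A' - t * B') = 0 := by
    rw [eA, eB] at hU
    rw [hw, hh']
    linear_combination hU - 4 * β ^ 3 * B' * h11
  have hβ0 : β ≠ 0 := by rw [hβ]; exact hz
  have eT : (s - t) ^ 2 * ((β'' * h - β * h'') * h - 2 * h' * (β' * h - β * h'))
      = (s - t) ^ 2 * β ^ 2 * w + 2 * β * e * ((s - t) * h') := by
    rw [hhz]
    linear_combination ((s-t)^2 * β^2) * e2 + (2 * β * (s-t) * h') * e1
  have eU2 : (s - t) ^ 2 * β ^ 2 * w + 2 * β * e * ((s - t) * h') = 0 := by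
    apply mul_left_cancel₀ (pow_ne_zero 2 hβ0)
    rw [← eA']
    linear_combination (s - t) ^ 2 * eU
  rw [eU2] at eT
  exact (mul_eq_zero.1 eT).resolve_left (pow_ne_zero 2 hδ)

end Jets

section Rays

open Polynomial MvPolynomial

/-- Restriction of a trivariate polynomial to the null line `x ↦ (x, b + t x, c + t² x)`. -/
noncomputable def restrictRay {E : Type*} [Field E] (t b c : E) :
    MvPolynomial (Fin 3) E →ₐ[E] E[X] :=
  MvPolynomial.aeval ![Polynomial.X, Polynomial.C b + Polynomial.C t * Polynomial.X,
    Polynomial.C c + Polynomial.C (t ^ 2) * Polynomial.X]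

lemma natDegree_restrictRay_le {E : Type*} [Field E] (t b c : E) {P : MvPolynomial (Fin 3) E}
    {n : ℕ} (hP : P.totalDegree ≤ n) : (restrictRay t b c P).natDegree ≤ n := by
  have := MvPolynomial.aeval_natDegree_le P hP ![Polynomial.X, Polynomial.C b +
    Polynomial.C t * Polynomial.X, Polynomial.C c + Polynomial.C (t ^ 2) * Polynomial.X]
    (n := 1) (by
      intro i
      fin_cases i
      · exact natDegree_X_le
      · simp only [Fin.mk_one, Matrix.cons_val_one, Matrix.cons_val_zero]
        compute_degree
      · simp only [Fin.reduceFinMk, Matrix.cons_val]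
        compute_degree)
  simpa [restrictRay] using this

lemma eval_restrictRay {E : Type*} [Field E] (t b c x : E) (P : MvPolynomial (Fin 3) E) :
    (restrictRay t b c P).eval x = MvPolynomial.eval ![x, b + t * x, c + t ^ 2 * x] P := by
  rw [restrictRay, MvPolynomial.aeval_def, ← Polynomial.coe_evalRingHom,
    MvPolynomial.hom_eval₂]
  have : (Polynomial.evalRingHom x).comp (algebraMap E E[X]) = RingHom.id E := by
    ext; simp
  rw [this, ← MvPolynomial.eval₂_id]
  congr 1
  ext i
  fin_cases i <;> simp

lemma derivative_restrictRay {E : Type*} [Field E] (t b c : E) (P : MvPolynomial (Fin 3) E) :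
    derivative (restrictRay t b c P) = restrictRay t b c (pderiv 0 P)
      + Polynomial.C t * restrictRay t b c (pderiv 1 P)
      + Polynomial.C (t ^ 2) * restrictRay t b c (pderiv 2 P) := by
  induction P using MvPolynomial.induction_on with
  | C a => simp [restrictRay]
  | add p q hp hq => simp only [map_add, hp, hq]; ring
  | mul_X p i hp =>
    simp only [map_mul, derivative_mul, hp, Derivation.leibniz, smul_eq_mul, map_add]
    fin_cases i <;> simp [restrictRay, MvPolynomial.pderiv_X, derivative_pow] <;> ring

lemma totalDegree_pderiv_lt {E σ : Type*} [Field E] [DecidableEq σ] (i : σ) {P : MvPolynomial σ E}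
    (h : pderiv i P ≠ 0) : (pderiv i P).totalDegree < P.totalDegree := by
  obtain ⟨m, hm⟩ := MvPolynomial.exists_coeff_ne_zero h
  have key : ∀ m ∈ (pderiv i P).support, (m.sum fun _ e => e) + 1 ≤ P.totalDegree := by
    intro m hm
    rw [MvPolynomial.mem_support_iff, coeff_pderiv] at hm
    have h1 := MvPolynomial.le_totalDegree (p := P) (s := m + Finsupp.single i 1)
      (MvPolynomial.mem_support_iff.2 (left_ne_zero_of_mul hm))
    rwa [Finsupp.sum_add_index' (fun _ => rfl) (fun _ _ _ => rfl), Finsupp.sum_single_index rfl]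
      at h1
  rw [MvPolynomial.totalDegree, Finset.sup_lt_iff]
  · intro m hm; exact key m hm
  · have := key m (MvPolynomial.mem_support_iff.2 hm)
    simp only [bot_eq_zero]; omega

lemma totalDegree_pderiv_le {E σ : Type*} [Field E] [DecidableEq σ] (i : σ)
    (P : MvPolynomial σ E) : (pderiv i P).totalDegree ≤ P.totalDegree := by
  by_cases h : pderiv i P = 0
  · rw [h]; simp
  · exact (totalDegree_pderiv_lt i h).le

lemma pderiv_comm' {E σ : Type*} [Field E] (i j : σ)
    (P : MvPolynomial σ E) : pderiv i (pderiv j P) = pderiv j (pderiv i P) := by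
  ext m
  simp only [coeff_pderiv]
  by_cases h : i = j
  · subst h; rfl
  · rw [add_right_comm]
    simp [h, Ne.symm h]
    ring

/-- A polynomial of small degree all of whose partial derivatives vanish is constant. -/
lemma eq_C_of_pderiv_eq_zero {E σ : Type*} [Field E] {P : MvPolynomial σ E}
    (hn : ∀ j : ℕ, 0 < j → j ≤ P.totalDegree → (j : E) ≠ 0)
    (h : ∀ i, pderiv i P = 0) : ∃ a, P = MvPolynomial.C a := by
  classical
  refine ⟨P.coeff 0, ?_⟩
  ext m
  rw [MvPolynomial.coeff_C]
  split_ifs with hm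
  · rw [hm]
  by_contra hne
  obtain ⟨i, hi⟩ : ∃ i, m i ≠ 0 := by
    by_contra! hc
    exact hm (Finsupp.ext fun i => (hc i).symm)
  have h1 := congrArg (MvPolynomial.coeff (m - Finsupp.single i 1)) (h i)
  rw [coeff_pderiv, tsub_add_cancel_of_le (by simpa [Nat.one_le_iff_ne_zero] using hi)] at h1
  have h2 := MvPolynomial.le_totalDegree (MvPolynomial.mem_support_iff.2 hne)
  have h3 : m i ≤ m.sum fun _ e => e := by
    rw [Finsupp.sum]
    exact Finset.single_le_sum (f := fun j => m j) (fun _ _ => Nat.zero_le _)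
      (Finsupp.mem_support_iff.2 hi)
  have h4 : (m i : E) = 0 := by
    rcases mul_eq_zero.1 h1 with h5 | h5
    · exact absurd h5 hne
    · rw [← h5]
      simp only [Finsupp.coe_tsub, Pi.sub_apply, Finsupp.single_eq_same]
      rw [Nat.cast_sub (by omega)]; simp
  exact hn (m i) (by omega) (h3.trans h2) h4

/-- There is a nonzero polynomial of degree `O(√m)` vanishing on `m` given null lines. -/
lemma exists_vanishing_on_rays {E ι : Type*} [Field E] (L : Finset ι) (t b c : ι → E)
    {d : ℕ} (hd : L.card * (3 * d + 1) < (d + 1) ^ 3) :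
    ∃ P : MvPolynomial (Fin 3) E, P ≠ 0 ∧ P.totalDegree ≤ 3 * d ∧
      ∀ i ∈ L, restrictRay (t i) (b i) (c i) P = 0 := by
  classical
  let mon : (Fin 3 → Fin (d + 1)) → (Fin 3 →₀ ℕ) := fun f =>
    Finsupp.equivFunOnFinite.symm fun i => (f i : ℕ)
  have mon_inj : Function.Injective mon := by
    intro f g hfg
    ext i
    have := DFunLike.congr_fun hfg i
    simpa [mon] using this
  let poly : ((Fin 3 → Fin (d + 1)) → E) →ₗ[E] MvPolynomial (Fin 3) E :=
    ∑ f, (MvPolynomial.monomial (mon f)).comp (LinearMap.proj f)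
  have poly_apply : ∀ v, poly v = ∑ f, MvPolynomial.monomial (mon f) (v f) := by
    intro v; simp [poly]
  have poly_coeff : ∀ v f, (poly v).coeff (mon f) = v f := by
    intro v f
    rw [poly_apply, MvPolynomial.coeff_sum]
    simp [MvPolynomial.coeff_monomial, mon_inj.eq_iff]
  have poly_deg : ∀ v, (poly v).totalDegree ≤ 3 * d := by
    intro v
    rw [poly_apply]
    refine MvPolynomial.totalDegree_finsetSum_le fun f _ => ?_
    refine (MvPolynomial.totalDegree_monomial_le _ _).trans ?_
    rw [Finsupp.sum_fintype _ _ (fun _ => rfl), Fin.sum_univ_three]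
    have h0 := (f 0).is_lt
    have h1 := (f 1).is_lt
    have h2 := (f 2).is_lt
    simp only [mon, Finsupp.coe_equivFunOnFinite_symm, id]
    omega
  let Φ : ((Fin 3 → Fin (d + 1)) → E) →ₗ[E] (L → Fin (3 * d + 1) → E) :=
    LinearMap.pi fun i => LinearMap.pi fun j =>
      (Polynomial.lcoeff E (j : ℕ)).comp
        ((restrictRay (t i) (b i) (c i)).toLinearMap.comp poly)
  have hker : LinearMap.ker Φ ≠ ⊥ := by
    apply LinearMap.ker_ne_bot_of_finrank_lt
    simp only [Module.finrank_pi_fintype, Module.finrank_self]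
    simp
    simpa using hd
  obtain ⟨v, hv, hv0⟩ := Submodule.exists_mem_ne_zero_of_ne_bot hker
  refine ⟨poly v, ?_, poly_deg v, ?_⟩
  · intro h
    apply hv0
    ext f
    rw [← poly_coeff v f, h]; simp
  · intro i hi
    ext j
    by_cases hj : j < 3 * d + 1
    · have := congrFun (congrFun (LinearMap.mem_ker.1 hv) ⟨i, hi⟩) ⟨j, hj⟩
      simpa [Φ] using this
    · rw [Polynomial.coeff_zero]
      apply Polynomial.coeff_eq_zero_of_natDegree_lt
      have := natDegree_restrictRay_le (t i) (b i) (c i) (poly_deg v)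
      omega

end Rays

section RaySystems

open Polynomial MvPolynomial

/-- A family of null lines `x ↦ (b + t x, c + t² x)` with a relation which implies that the lines
meet, in such a way that distinct neighbours meet a given line in distinct points. -/
structure RaySystem (E ι : Type*) [Field E] where
  t : ι → E
  b : ι → E
  c : ι → E
  adj : ι → ι → Prop
  symm : ∀ {i j}, adj i j → adj j i
  ne : ∀ {i j}, adj i j → t i ≠ t j
  meet : ∀ {i j}, adj i j → c i - c j = (t i + t j) * (b i - b j)
  inj : ∀ {i j k}, adj i j → adj i k →
    (b i - b j) / (t j - t i) = (b i - b k) / (t k - t i) → j = k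

namespace RaySystem

variable {E ι : Type*} [Field E] (S : RaySystem E ι)

/-- Restriction of polynomials to the `i`-th line. -/
noncomputable def res (i : ι) : MvPolynomial (Fin 3) E →ₐ[E] E[X] :=
  restrictRay (S.t i) (S.b i) (S.c i)

/-- The first coordinate of the point where lines `i` and `j` meet. -/
def abscissa (i j : ι) : E := (S.b i - S.b j) / (S.t j - S.t i)

open Classical in
/-- The neighbours of `i` in `L`. -/
noncomputable def nbr (L : Finset ι) (i : ι) : Finset ι := L.filter fun j => S.adj i j

open Classical in
/-- The number of adjacent ordered pairs in `L`. -/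
noncomputable def edges (L : Finset ι) : ℕ := ((L ×ˢ L).filter fun p => S.adj p.1 p.2).card

open Classical in
/-- Every line has at most `k` neighbours lying with it on a common quadric. -/
def QuadricBound (k : ℕ) : Prop :=
  ∀ (L : Finset ι) (i : ι) (α β : E),
    ((S.nbr L i).filter fun j => α * (S.t j - S.t i) + β * (S.b i - S.b j) = 1).card ≤ k

lemma mem_nbr {L : Finset ι} {i j : ι} : j ∈ S.nbr L i ↔ j ∈ L ∧ S.adj i j := by
  simp [nbr]

lemma exists_common_point {i j : ι} (h : S.adj i j) : ∃ pt : Fin 3 → E,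
    (∀ Q, (S.res i Q).eval (S.abscissa i j) = MvPolynomial.eval pt Q) ∧
    (∀ Q, (S.res j Q).eval (S.abscissa i j) = MvPolynomial.eval pt Q) ∧
    (∀ Q, (S.res j Q).eval (S.abscissa j i) = MvPolynomial.eval pt Q) := by
  have hne : S.t j - S.t i ≠ 0 := sub_ne_zero.2 (S.ne h).symm
  have hne' : S.t i - S.t j ≠ 0 := sub_ne_zero.2 (S.ne h)
  have hx : (S.t j - S.t i) * S.abscissa i j = S.b i - S.b j := by
    rw [abscissa]; field_simp
  have hx' : S.abscissa j i = S.abscissa i j := by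
    rw [abscissa, abscissa, ← neg_sub (S.t j), ← neg_sub (S.b i), neg_div_neg_eq]
  have hpt : (![S.abscissa i j, S.b j + S.t j * S.abscissa i j,
      S.c j + S.t j ^ 2 * S.abscissa i j] : Fin 3 → E) = ![S.abscissa i j,
      S.b i + S.t i * S.abscissa i j, S.c i + S.t i ^ 2 * S.abscissa i j] := by
    have h1 : S.b j + S.t j * S.abscissa i j = S.b i + S.t i * S.abscissa i j := by
      linear_combination hx
    have h2 : S.c j + S.t j ^ 2 * S.abscissa i j = S.c i + S.t i ^ 2 * S.abscissa i j := by
      linear_combination (S.t i + S.t j) * hx - S.meet h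
    rw [h1, h2]
  refine ⟨_, fun Q => eval_restrictRay _ _ _ _ Q, fun Q => ?_, fun Q => ?_⟩
  · rw [res, eval_restrictRay, hpt]
  · rw [res, hx', eval_restrictRay, hpt]

lemma eq_zero_of_eval_abscissa {L : Finset ι} {i : ι} {f : E[X]}
    (hf : f.natDegree < (S.nbr L i).card)
    (h : ∀ j ∈ S.nbr L i, f.eval (S.abscissa i j) = 0) : f = 0 := by
  classical
  apply Polynomial.eq_zero_of_natDegree_lt_card_of_eval_eq_zero' f
    ((S.nbr L i).image (S.abscissa i))
  · intro x hx
    obtain ⟨j, hj, rfl⟩ := Finset.mem_image.1 hx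
    exact h j hj
  · rwa [Finset.card_image_of_injOn]
    intro j hj k hk hjk
    exact S.inj (S.mem_nbr.1 hj).2 (S.mem_nbr.1 hk).2 hjk

lemma derivative_res (i : ι) (Q : MvPolynomial (Fin 3) E) :
    derivative (S.res i Q) = S.res i (pderiv 0 Q)
      + Polynomial.C (S.t i) * S.res i (pderiv 1 Q)
      + Polynomial.C (S.t i ^ 2) * S.res i (pderiv 2 Q) :=
  derivative_restrictRay _ _ _ _

lemma res_first {i : ι} {P : MvPolynomial (Fin 3) E} (h : S.res i P = 0) :
    S.res i (pderiv 0 P) + Polynomial.C (S.t i) * S.res i (pderiv 1 P)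
      + Polynomial.C (S.t i ^ 2) * S.res i (pderiv 2 P) = 0 := by
  rw [← derivative_res, h, derivative_zero]

lemma res_second {i : ι} {P : MvPolynomial (Fin 3) E} (h : S.res i P = 0) :
    derivative (S.res i (pderiv 0 P)) + Polynomial.C (S.t i) * derivative (S.res i (pderiv 1 P))
      + Polynomial.C (S.t i ^ 2) * derivative (S.res i (pderiv 2 P)) = 0 := by
  have := congrArg derivative (S.res_first h)
  simpa only [derivative_add, derivative_C_mul, derivative_zero] using this

lemma res_third {i : ι} {P : MvPolynomial (Fin 3) E} (h : S.res i P = 0) :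
    derivative (derivative (S.res i (pderiv 0 P)))
      + Polynomial.C (S.t i) * derivative (derivative (S.res i (pderiv 1 P)))
      + Polynomial.C (S.t i ^ 2) * derivative (derivative (S.res i (pderiv 2 P))) = 0 := by
  have := congrArg derivative (S.res_second h)
  simpa only [derivative_add, derivative_C_mul, derivative_zero] using this

/-- The polynomial along line `j` expressing that the surface `P = 0` is umbilic. -/
noncomputable def umbilic (j : ι) (P : MvPolynomial (Fin 3) E) : E[X] :=
  let A := -(S.res j (pderiv 1 P) + Polynomial.C (S.t j) * S.res j (pderiv 2 P))
  let B := S.res j (pderiv 2 P)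
  B ^ 4 * S.res j (pderiv 0 (pderiv 0 P)) + 2 * (A * B ^ 3) * S.res j (pderiv 0 (pderiv 1 P))
    + A ^ 2 * B ^ 2 * (2 * S.res j (pderiv 0 (pderiv 2 P)) + S.res j (pderiv 1 (pderiv 1 P)))
    + 2 * (A ^ 3 * B) * S.res j (pderiv 1 (pderiv 2 P)) + A ^ 4 * S.res j (pderiv 2 (pderiv 2 P))

lemma natDegree_res_le (i : ι) {P : MvPolynomial (Fin 3) E} {n : ℕ} (h : P.totalDegree ≤ n) :
    (S.res i P).natDegree ≤ n := natDegree_restrictRay_le _ _ _ h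

lemma natDegree_umbilic_le (j : ι) (P : MvPolynomial (Fin 3) E) :
    (S.umbilic j P).natDegree ≤ 5 * P.totalDegree := by
  have h1 : ∀ a, (S.res j (pderiv a P)).natDegree ≤ P.totalDegree := fun a =>
    S.natDegree_res_le j (totalDegree_pderiv_le a P)
  have h2 : ∀ a a', (S.res j (pderiv a (pderiv a' P))).natDegree ≤ P.totalDegree := fun a a' =>
    S.natDegree_res_le j ((totalDegree_pderiv_le a _).trans (totalDegree_pderiv_le a' P))
  have hA : (-(S.res j (pderiv 1 P) + Polynomial.C (S.t j) * S.res j (pderiv 2 P))).natDegree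
      ≤ P.totalDegree := by
    rw [natDegree_neg]
    exact natDegree_add_le_of_degree_le (h1 1) ((natDegree_C_mul_le _ _).trans (h1 2))
  have hB := h1 2
  have two : (2 : E[X]).natDegree ≤ 0 := (natDegree_ofNat 2).le
  unfold umbilic
  generalize -(S.res j (pderiv 1 P) + Polynomial.C (S.t j) * S.res j (pderiv 2 P)) = A at hA
  generalize S.res j (pderiv 2 P) = B at hB
  refine natDegree_add_le_of_degree_le (natDegree_add_le_of_degree_le
    (natDegree_add_le_of_degree_le (natDegree_add_le_of_degree_le ?_ ?_) ?_) ?_) ?_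
  · exact (natDegree_mul_le_of_le (natDegree_pow_le_of_le 4 hB) (h2 0 0)).trans (by omega)
  · exact (natDegree_mul_le_of_le (natDegree_mul_le_of_le two (natDegree_mul_le_of_le hA
      (natDegree_pow_le_of_le 3 hB))) (h2 0 1)).trans (by omega)
  · exact (natDegree_mul_le_of_le (natDegree_mul_le_of_le (natDegree_pow_le_of_le 2 hA)
      (natDegree_pow_le_of_le 2 hB)) (natDegree_add_le_of_degree_le
      ((natDegree_mul_le_of_le two (h2 0 2)).trans (zero_add _).le) (h2 1 1))).trans (by omega)
  · exact (natDegree_mul_le_of_le (natDegree_mul_le_of_le two (natDegree_mul_le_of_le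
      (natDegree_pow_le_of_le 3 hA) hB)) (h2 1 2)).trans (by omega)
  · exact (natDegree_mul_le_of_le (natDegree_pow_le_of_le 4 hA) (h2 2 2)).trans (by omega)

section Surface

variable {S} {L : Finset ι} {P : MvPolynomial (Fin 3) E}

lemma first_order_at_meet (hvan : ∀ i ∈ L, S.res i P = 0) {i : ι} (hi : i ∈ L) {x : E}
    {pt : Fin 3 → E} (h : ∀ Q, (S.res i Q).eval x = MvPolynomial.eval pt Q) :
    MvPolynomial.eval pt (pderiv 0 P) + S.t i * MvPolynomial.eval pt (pderiv 1 P)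
      + S.t i ^ 2 * MvPolynomial.eval pt (pderiv 2 P) = 0 := by
  have := congrArg (Polynomial.eval x) (S.res_first (hvan i hi))
  simpa only [Polynomial.eval_add, Polynomial.eval_mul, Polynomial.eval_C, h,
    Polynomial.eval_zero] using this

lemma second_order_at_meet (hvan : ∀ i ∈ L, S.res i P = 0) {i : ι} (hi : i ∈ L) {x : E}
    {pt : Fin 3 → E} (h : ∀ Q, (S.res i Q).eval x = MvPolynomial.eval pt Q) :
    (MvPolynomial.eval pt (pderiv 0 (pderiv 0 P))
        + S.t i * MvPolynomial.eval pt (pderiv 0 (pderiv 1 P))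
        + S.t i ^ 2 * MvPolynomial.eval pt (pderiv 0 (pderiv 2 P)))
      + S.t i * (MvPolynomial.eval pt (pderiv 0 (pderiv 1 P))
        + S.t i * MvPolynomial.eval pt (pderiv 1 (pderiv 1 P))
        + S.t i ^ 2 * MvPolynomial.eval pt (pderiv 1 (pderiv 2 P)))
      + S.t i ^ 2 * (MvPolynomial.eval pt (pderiv 0 (pderiv 2 P))
        + S.t i * MvPolynomial.eval pt (pderiv 1 (pderiv 2 P))
        + S.t i ^ 2 * MvPolynomial.eval pt (pderiv 2 (pderiv 2 P))) = 0 := by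
  have := congrArg (Polynomial.eval x) (S.res_second (hvan i hi))
  simpa only [Polynomial.eval_add, Polynomial.eval_mul, Polynomial.eval_C, h,
    Polynomial.eval_zero, derivative_res, pderiv_comm' (1 : Fin 3) 0,
    pderiv_comm' (2 : Fin 3) 0, pderiv_comm' (2 : Fin 3) 1]
    using this

lemma umbilic_eq_zero (hvan : ∀ i ∈ L, S.res i P = 0) {j : ι} (hj : j ∈ L)
    (hdeg : 5 * P.totalDegree < (S.nbr L j).card) : S.umbilic j P = 0 := by
  apply S.eq_zero_of_eval_abscissa ((S.natDegree_umbilic_le j P).trans_lt hdeg)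
  intro i hi
  obtain ⟨hi, hadj⟩ := S.mem_nbr.1 hi
  obtain ⟨pt, hpj, hpi, -⟩ := S.exists_common_point hadj
  have h1 := first_order_at_meet hvan hi hpi
  have h2 := first_order_at_meet hvan hj hpj
  have h11 := second_order_at_meet hvan hi hpi
  simp only [umbilic, Polynomial.eval_add, Polynomial.eval_mul, Polynomial.eval_C, hpj,
    Polynomial.eval_neg, Polynomial.eval_pow, Polynomial.eval_ofNat]
  have hδ : S.t j - S.t i ≠ 0 := sub_ne_zero.2 (S.ne hadj)
  have hA : -(MvPolynomial.eval pt (pderiv 1 P) + S.t j * MvPolynomial.eval pt (pderiv 2 P))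
      = S.t i * MvPolynomial.eval pt (pderiv 2 P) := by
    apply mul_left_cancel₀ hδ; linear_combination h1 - h2
  rw [hA]
  linear_combination (MvPolynomial.eval pt (pderiv 2 P)) ^ 4 * h11

end Surface

end RaySystem

end RaySystems

section RaySurface

open Polynomial MvPolynomial

namespace RaySystem

variable {E ι : Type*} [Field E] {S : RaySystem E ι} {L : Finset ι} {P : MvPolynomial (Fin 3) E}

lemma third_order_at_meet (hvan : ∀ i ∈ L, S.res i P = 0) {i : ι} (hi : i ∈ L) {x : E}
    {pt : Fin 3 → E} (h : ∀ Q, (S.res i Q).eval x = MvPolynomial.eval pt Q) :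
    MvPolynomial.eval pt (pderiv 0 (pderiv 0 (pderiv 0 P)))
      + 3 * S.t i * MvPolynomial.eval pt (pderiv 0 (pderiv 0 (pderiv 1 P)))
      + 3 * S.t i ^ 2 * (MvPolynomial.eval pt (pderiv 0 (pderiv 0 (pderiv 2 P)))
        + MvPolynomial.eval pt (pderiv 0 (pderiv 1 (pderiv 1 P))))
      + S.t i ^ 3 * (6 * MvPolynomial.eval pt (pderiv 0 (pderiv 1 (pderiv 2 P)))
        + MvPolynomial.eval pt (pderiv 1 (pderiv 1 (pderiv 1 P))))
      + 3 * S.t i ^ 4 * (MvPolynomial.eval pt (pderiv 0 (pderiv 2 (pderiv 2 P)))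
        + MvPolynomial.eval pt (pderiv 1 (pderiv 1 (pderiv 2 P))))
      + 3 * S.t i ^ 5 * MvPolynomial.eval pt (pderiv 1 (pderiv 2 (pderiv 2 P)))
      + S.t i ^ 6 * MvPolynomial.eval pt (pderiv 2 (pderiv 2 (pderiv 2 P))) = 0 := by
  have := congrArg (Polynomial.eval x) (S.res_third (hvan i hi))
  simp only [Polynomial.eval_add, Polynomial.eval_mul, Polynomial.eval_C, h, derivative_add,
    derivative_C_mul, Polynomial.eval_zero, derivative_res, pderiv_comm' (1 : Fin 3) 0,
    pderiv_comm' (2 : Fin 3) 0, pderiv_comm' (2 : Fin 3) 1] at this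
  linear_combination this

/-- The derivative of `P` in the second and third direction along line `i`. -/
noncomputable def slope (i : ι) (S : RaySystem E ι) (P : MvPolynomial (Fin 3) E) : E[X] :=
  S.res i (pderiv 1 P) + Polynomial.C (2 * S.t i) * S.res i (pderiv 2 P)

lemma natDegree_slope_le (i : ι) (S : RaySystem E ι) (P : MvPolynomial (Fin 3) E) :
    (slope i S P).natDegree ≤ P.totalDegree := by
  have h1 : ∀ a, (S.res i (pderiv a P)).natDegree ≤ P.totalDegree := fun a =>
    S.natDegree_res_le i (totalDegree_pderiv_le a P)
  exact natDegree_add_le_of_degree_le (h1 1) ((natDegree_C_mul_le _ _).trans (h1 2))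

lemma slope_at_meet (hvan : ∀ i ∈ L, S.res i P = 0) {i j : ι} (hi : i ∈ L) (hj : j ∈ S.nbr L i) :
    (slope i S P).eval (S.abscissa i j)
      = -(S.t j - S.t i) * (S.res i (pderiv 2 P)).eval (S.abscissa i j) := by
  obtain ⟨hj, hadj⟩ := S.mem_nbr.1 hj
  obtain ⟨pt, hpi, hpj, -⟩ := S.exists_common_point hadj
  have h1 := first_order_at_meet hvan hi hpi
  have h2 := first_order_at_meet hvan hj hpj
  simp only [slope, Polynomial.eval_add, Polynomial.eval_mul, Polynomial.eval_C, hpi]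
  apply mul_left_cancel₀ (sub_ne_zero.2 (S.ne hadj).symm)
  linear_combination h2 - h1

lemma second_order_slope (hvan : ∀ i ∈ L, S.res i P = 0) {i : ι} (hi : i ∈ L)
    (hdeg : ∀ j ∈ L, 5 * P.totalDegree < (S.nbr L j).card) :
    (derivative (derivative (S.res i (pderiv 2 P))) * slope i S P
      - S.res i (pderiv 2 P) * derivative (derivative (slope i S P))) * slope i S P
      - 2 * derivative (slope i S P) * (derivative (S.res i (pderiv 2 P)) * slope i S P
        - S.res i (pderiv 2 P) * derivative (slope i S P)) = 0 := by
  apply S.eq_zero_of_eval_abscissa (L := L) (i := i)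
  · refine lt_of_le_of_lt ?_ (hdeg i hi)
    have hβ : (S.res i (pderiv 2 P)).natDegree ≤ P.totalDegree :=
      S.natDegree_res_le i (totalDegree_pderiv_le 2 P)
    have hh := natDegree_slope_le i S P
    have hD : ∀ {f : E[X]}, f.natDegree ≤ P.totalDegree →
        (derivative f).natDegree ≤ P.totalDegree := fun h =>
      (natDegree_derivative_le _).trans ((Nat.sub_le _ _).trans h)
    have two : (2 : E[X]).natDegree ≤ 0 := (natDegree_ofNat 2).le
    refine (natDegree_sub_le_of_le (natDegree_mul_le_of_le (natDegree_sub_le_of_le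
      (natDegree_mul_le_of_le (hD (hD hβ)) hh) (natDegree_mul_le_of_le hβ (hD (hD hh)))) hh)
      (natDegree_mul_le_of_le (natDegree_mul_le_of_le two (hD hh)) (natDegree_sub_le_of_le
      (natDegree_mul_le_of_le (hD hβ) hh) (natDegree_mul_le_of_le hβ (hD hh))))).trans ?_
    simp only [max_self]; omega
  · intro j hj
    obtain ⟨hjL, hadj⟩ := S.mem_nbr.1 hj
    obtain ⟨pt, hpi, -, hpj⟩ := S.exists_common_point hadj
    obtain ⟨pt', hpi', hpj', -⟩ := S.exists_common_point hadj
    have hu := congrArg (Polynomial.eval (S.abscissa j i)) (congrArg derivative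
      (umbilic_eq_zero hvan hjL (hdeg j hjL)))
    simp only [umbilic, derivative_add, derivative_mul, derivative_pow, derivative_neg,
      derivative_C, derivative_ofNat, derivative_zero, derivative_res, Polynomial.eval_add,
      Polynomial.eval_mul, Polynomial.eval_C, Polynomial.eval_neg, Polynomial.eval_pow, Polynomial.eval_ofNat,
      hpj, pderiv_comm' (1 : Fin 3) 0, Nat.cast_ofNat, Polynomial.C_ofNat, Polynomial.eval_zero,
      pderiv_comm' (2 : Fin 3) 0, pderiv_comm' (2 : Fin 3) 1] at hu
    have h1 := first_order_at_meet hvan hi hpi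
    have h2 := first_order_at_meet hvan hjL hpj
    have h11 := second_order_at_meet hvan hi hpi
    have h22 := second_order_at_meet hvan hjL hpj
    have h111 := third_order_at_meet hvan hi hpi
    simp only [slope, derivative_add, derivative_mul,
      derivative_C, derivative_zero, derivative_res, Polynomial.eval_add, Polynomial.eval_mul,
      Polynomial.eval_C, hpi, pderiv_comm' (1 : Fin 3) 0, Polynomial.eval_sub, Polynomial.eval_zero,
      Polynomial.eval_ofNat, pderiv_comm' (2 : Fin 3) 0, pderiv_comm' (2 : Fin 3) 1]
    apply second_order_eq_zero_of_jets (S.ne hadj) h1 h2 h11 h22 h111 rfl rfl rfl rfl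
    · linear_combination hu
    · ring
    · rfl
    · ring
    · rfl
    · ring
    · ring

lemma exists_nbr_card_le {k n : ℕ} (hQ : S.QuadricBound k) (hL : L.Nonempty)
    (hchar : ∀ j : ℕ, 0 < j → j ≤ 2 * n → (j : E) ≠ 0)
    (hP : ∃ P : MvPolynomial (Fin 3) E, P ≠ 0 ∧ P.totalDegree ≤ n ∧ ∀ i ∈ L, S.res i P = 0) :
    ∃ i ∈ L, (S.nbr L i).card ≤ 5 * n + k := by
  classical
  by_contra! hbig
  have hex : ∃ D, ∃ P : MvPolynomial (Fin 3) E, P ≠ 0 ∧ P.totalDegree = D ∧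
      ∀ i ∈ L, S.res i P = 0 := by
    obtain ⟨P, h1, -, h3⟩ := hP
    exact ⟨_, P, h1, rfl, h3⟩
  obtain ⟨P, hP0, hPD, hvan⟩ := Nat.find_spec hex
  have hPn : P.totalDegree ≤ n := by
    obtain ⟨P', h1, h2, h3⟩ := hP
    rw [hPD]
    exact (Nat.find_min' hex ⟨P', h1, rfl, h3⟩).trans h2
  have hmin : ∀ a, (∀ i ∈ L, S.res i (pderiv a P) = 0) → pderiv a P = 0 := by
    intro a ha
    by_contra hne
    have := totalDegree_pderiv_lt a hne
    rw [hPD] at this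
    exact Nat.find_min hex this ⟨_, hne, rfl, ha⟩
  have hdeg : ∀ a i, (S.res i (pderiv a P)).natDegree ≤ n := fun a i =>
    S.natDegree_res_le i ((totalDegree_pderiv_le a P).trans hPn)
  obtain ⟨i, hi, hgood⟩ : ∃ i ∈ L, S.res i (pderiv 2 P) ≠ 0 := by
    by_contra! hbad
    have hz : pderiv 2 P = 0 := hmin 2 hbad
    have hy : pderiv 1 P = 0 := by
      refine hmin 1 fun i hi => S.eq_zero_of_eval_abscissa (L := L) (i := i) ?_ fun j hj => ?_
      · exact (hdeg 1 i).trans_lt (lt_of_le_of_lt (by omega) (hbig i hi))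
      · have h1 := slope_at_meet hvan hi hj
        simpa [slope, hz] using h1
    have hx : pderiv 0 P = 0 := by
      refine hmin 0 fun i hi => ?_
      simpa [hy, hz] using S.res_first (hvan i hi)
    obtain ⟨a, ha⟩ := eq_C_of_pderiv_eq_zero (P := P)
      (fun j hj hjn => hchar j hj (by omega)) (by
        intro a; fin_cases a
        · exact hx
        · exact hy
        · exact hz)
    obtain ⟨i, hi⟩ := hL
    have h0 := hvan i hi
    rw [ha] at h0 hP0
    rw [← MvPolynomial.algebraMap_eq, AlgHom.commutes] at h0
    apply hP0
    rw [Polynomial.algebraMap_apply, Algebra.algebraMap_self, RingHom.id_apply,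
      Polynomial.C_eq_zero] at h0
    rw [h0, MvPolynomial.C_0]
  have hT := second_order_slope hvan hi (fun j hj => lt_of_le_of_lt (by omega) (hbig j hj))
  have hvalne : ∃ j ∈ S.nbr L i, (S.res i (pderiv 2 P)).eval (S.abscissa i j) ≠ 0 := by
    by_contra! hall
    exact hgood (S.eq_zero_of_eval_abscissa
      ((hdeg 2 i).trans_lt (lt_of_le_of_lt (by omega) (hbig i hi))) hall)
  have hslope : slope i S P ≠ 0 := by
    obtain ⟨j, hj, hne⟩ := hvalne
    intro h0
    have h1 := slope_at_meet hvan hi hj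
    rw [h0, Polynomial.eval_zero] at h1
    exact mul_ne_zero (neg_ne_zero.2 (sub_ne_zero.2 (S.ne (S.mem_nbr.1 hj).2).symm)) hne h1.symm
  obtain ⟨κ₁, κ₀, hκ⟩ := exists_affine_mul_of_second_order hchar (hdeg 2 i)
    ((natDegree_slope_le i S P).trans hPn) hslope hT
  have hsub : S.nbr L i ⊆ ((S.nbr L i).filter fun j =>
      -κ₀ * (S.t j - S.t i) + -κ₁ * (S.b i - S.b j) = 1) ∪
      ((S.nbr L i).filter fun j => (S.res i (pderiv 2 P)).eval (S.abscissa i j) = 0) := by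
    intro j hj
    rw [Finset.mem_union, Finset.mem_filter, Finset.mem_filter]
    by_cases h0 : (S.res i (pderiv 2 P)).eval (S.abscissa i j) = 0
    · exact Or.inr ⟨hj, h0⟩
    · refine Or.inl ⟨hj, ?_⟩
      have h1 := slope_at_meet hvan hi hj
      have h2 := congrArg (Polynomial.eval (S.abscissa i j)) hκ
      simp only [Polynomial.eval_mul, Polynomial.eval_add, Polynomial.eval_C,
        Polynomial.eval_X] at h2
      have hne : S.t j - S.t i ≠ 0 := sub_ne_zero.2 (S.ne (S.mem_nbr.1 hj).2).symm
      have hx : (S.t j - S.t i) * S.abscissa i j = S.b i - S.b j := by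
        rw [abscissa]; field_simp
      rw [← hx]
      apply mul_right_cancel₀ h0
      rw [h1] at h2
      linear_combination -h2
  have hcard : ((S.nbr L i).filter fun j =>
      (S.res i (pderiv 2 P)).eval (S.abscissa i j) = 0).card ≤ n := by
    rw [← Finset.card_image_of_injOn (f := S.abscissa i)]
    · refine le_trans (Finset.card_le_card (t := (S.res i (pderiv 2 P)).roots.toFinset) ?_)
        ((Multiset.toFinset_card_le _).trans ((Polynomial.card_roots' _).trans (hdeg 2 i)))
      intro x hx
      obtain ⟨j, hj, rfl⟩ := Finset.mem_image.1 hx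
      rw [Multiset.mem_toFinset, Polynomial.mem_roots hgood]
      exact (Finset.mem_filter.1 hj).2
    · intro j hj j' hj' h
      exact S.inj (S.mem_nbr.1 (Finset.mem_filter.1 hj).1).2
        (S.mem_nbr.1 (Finset.mem_filter.1 hj').1).2 h
  have h1 := (Finset.card_le_card hsub).trans (Finset.card_union_le _ _)
  have h2 := hQ L i (-κ₀) (-κ₁)
  have h3 := hbig i hi
  have h4 : ((S.nbr L i).filter fun j =>
      -κ₀ * (S.t j - S.t i) + -κ₁ * (S.b i - S.b j) = 1).card ≤ k := by
    convert h2
  omega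

variable (S) in
lemma edges_le_erase [DecidableEq ι] (L : Finset ι) (i : ι) :
    S.edges L ≤ S.edges (L.erase i) + 2 * (S.nbr L i).card := by
  classical
  have hsub : ((L ×ˢ L).filter fun p => S.adj p.1 p.2) ⊆
      (((L.erase i) ×ˢ (L.erase i)).filter fun p => S.adj p.1 p.2) ∪
        ((S.nbr L i).image (fun j => (i, j)) ∪ (S.nbr L i).image (fun j => (j, i))) := by
    rintro ⟨a, b⟩ h
    simp only [Finset.mem_filter, Finset.mem_product] at h
    obtain ⟨⟨ha, hb⟩, hab⟩ := h
    simp only [Finset.mem_union, Finset.mem_filter, Finset.mem_product, Finset.mem_erase,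
      Finset.mem_image, mem_nbr, Prod.mk.injEq]
    by_cases h1 : a = i
    · subst h1; exact Or.inr (Or.inl ⟨b, ⟨hb, hab⟩, rfl, rfl⟩)
    · by_cases h2 : b = i
      · subst h2; exact Or.inr (Or.inr ⟨a, ⟨ha, S.symm hab⟩, rfl, rfl⟩)
      · exact Or.inl ⟨⟨⟨h1, ha⟩, h2, hb⟩, hab⟩
  have h1 := (Finset.card_le_card hsub).trans (Finset.card_union_le _ _)
  have h2 := Finset.card_union_le ((S.nbr L i).image (fun j => (i, j)))
    ((S.nbr L i).image (fun j => (j, i)))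
  have h3 := Finset.card_image_le (s := S.nbr L i) (f := fun j => (i, j))
  have h4 := Finset.card_image_le (s := S.nbr L i) (f := fun j => (j, i))
  have e1 : S.edges L = ((L ×ˢ L).filter fun p => S.adj p.1 p.2).card := by
    unfold edges; congr
  have e2 : S.edges (L.erase i)
      = (((L.erase i) ×ˢ (L.erase i)).filter fun p => S.adj p.1 p.2).card := by
    unfold edges; congr
  omega

/-- The incidence bound for small sets of lines. -/
theorem edges_le {k N : ℕ} (hQ : S.QuadricBound k)
    (hchar : ∀ j : ℕ, 0 < j → j ≤ 6 * Nat.sqrt (3 * N) → (j : E) ≠ 0) (L : Finset ι)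
    (hL : L.card ≤ N) : S.edges L ≤ L.card * (2 * (15 * Nat.sqrt (3 * N) + k)) := by
  classical
  induction hm : L.card generalizing L with
  | zero =>
    rw [Finset.card_eq_zero] at hm
    simp [edges, hm]
  | succ m ih =>
    have hne : L.Nonempty := Finset.card_pos.1 (by omega)
    obtain ⟨i, hi, hdeg⟩ := exists_nbr_card_le (n := 3 * Nat.sqrt (3 * N)) hQ hne
      (fun j hj hjn => hchar j hj (by omega)) (by
        apply exists_vanishing_on_rays L S.t S.b S.c
        have h1 := Nat.lt_succ_sqrt (3 * N)
        simp only [Nat.succ_eq_add_one] at h1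
        set d := Nat.sqrt (3 * N)
        calc L.card * (3 * d + 1) ≤ N * (3 * d + 3) := Nat.mul_le_mul hL (by omega)
          _ = 3 * N * (d + 1) := by ring
          _ < (d + 1) * (d + 1) * (d + 1) := Nat.mul_lt_mul_of_pos_right h1 (by omega)
          _ = (d + 1) ^ 3 := by ring)
    have hc := Finset.card_erase_of_mem hi
    have h1 := ih (L.erase i) (by omega) (by omega)
    have h2 := S.edges_le_erase L i
    rw [add_mul, one_mul]
    omega

end RaySystem

end RaySurface

section RaySplitting

namespace RaySystem

variable {E ι : Type*} [Field E] {S : RaySystem E ι}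

lemma edges_le_of_card_le_mul {k J N : ℕ} (hQ : S.QuadricBound k)
    (hchar : ∀ j : ℕ, 0 < j → j ≤ 6 * Nat.sqrt (3 * (2 * N)) → (j : E) ≠ 0) (L : Finset ι)
    (hN : 0 < N) (hL : L.card ≤ J * N) :
    S.edges L ≤ J ^ 2 * (2 * N * (2 * (15 * Nat.sqrt (3 * (2 * N)) + k))) := by
  classical
  let f : ι → ℕ := fun x => if h : x ∈ L then (L.equivFin ⟨x, h⟩ : ℕ) / N else 0
  have hf : ∀ x ∈ L, f x ∈ Finset.range J := by
    intro x hx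
    simp only [f, hx, dif_pos, Finset.mem_range]
    exact Nat.div_lt_of_lt_mul (by
      rw [mul_comm]; exact lt_of_lt_of_le (L.equivFin ⟨x, hx⟩).2 hL)
  have hcls : ∀ a, (L.filter fun x => f x = a).card ≤ N := by
    intro a
    rw [← Finset.card_range N]
    refine Finset.card_le_card_of_injOn
      (fun x => if h : x ∈ L then (L.equivFin ⟨x, h⟩ : ℕ) % N else 0) ?_ ?_
    · intro x hx
      have hx := (Finset.mem_filter.1 hx).1
      simpa [hx] using Nat.mod_lt _ hN
    · intro x hx y hy hxy
      obtain ⟨hx, hxa⟩ := Finset.mem_filter.1 hx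
      obtain ⟨hy, hya⟩ := Finset.mem_filter.1 hy
      simp only [f, hx, hy, dif_pos] at hxa hya hxy
      have h1 := Nat.div_add_mod (L.equivFin ⟨x, hx⟩ : ℕ) N
      have h2 := Nat.div_add_mod (L.equivFin ⟨y, hy⟩ : ℕ) N
      rw [hxa, hxy] at h1
      rw [hya, h1] at h2
      have := L.equivFin.injective (Fin.ext h2)
      exact congrArg Subtype.val this
  let part : ℕ × ℕ → Finset ι := fun ab =>
    (L.filter fun x => f x = ab.1) ∪ (L.filter fun x => f x = ab.2)
  have hpart : ∀ ab, (part ab).card ≤ 2 * N := fun ab =>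
    (Finset.card_union_le _ _).trans (by have := hcls ab.1; have := hcls ab.2; omega)
  have hsub : ((L ×ˢ L).filter fun p => S.adj p.1 p.2) ⊆
      (Finset.range J ×ˢ Finset.range J).biUnion fun ab =>
        ((part ab ×ˢ part ab).filter fun p => S.adj p.1 p.2) := by
    rintro ⟨x, y⟩ h
    simp only [Finset.mem_filter, Finset.mem_product] at h
    rw [Finset.mem_biUnion]
    refine ⟨(f x, f y), Finset.mem_product.2 ⟨hf x h.1.1, hf y h.1.2⟩, ?_⟩
    simp [part, h]
  have e1 : S.edges L = ((L ×ˢ L).filter fun p => S.adj p.1 p.2).card := by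
    unfold edges; congr
  rw [e1]
  refine (Finset.card_le_card hsub).trans (Finset.card_biUnion_le.trans ?_)
  have : J ^ 2 = (Finset.range J ×ˢ Finset.range J).card := by simp [sq]
  rw [this, ← smul_eq_mul]
  refine Finset.sum_le_card_nsmul _ _ _ fun ab _ => ?_
  have e2 : ((part ab ×ˢ part ab).filter fun p => S.adj p.1 p.2).card = S.edges (part ab) := by
    unfold edges; congr
  rw [e2]
  exact (edges_le hQ hchar _ (hpart ab)).trans (Nat.mul_le_mul_right _ (hpart ab))

/-- The incidence bound for sets of lines of size at most a multiple of the squared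
characteristic. -/
theorem edges_le_of_card_le_sq {k p : ℕ} (hQ : S.QuadricBound k) (hp : 30 ≤ p)
    (hchar : ∀ j : ℕ, 0 < j → j < p → (j : E) ≠ 0) (L : Finset ι) (hL : L.card ≤ 6 * p ^ 2) :
    S.edges L ≤ 16000000 * (L.card * (15 * Nat.sqrt (6 * L.card) + k)) := by
  rcases Nat.eq_zero_or_pos L.card with h0 | h0
  · rw [Finset.card_eq_zero] at h0
    simp [edges, h0]
  have hN : L.card / 2000 + 1 ≤ L.card := by omega
  have hp2 : 900 ≤ p ^ 2 := by nlinarith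
  have hs : 6 * Nat.sqrt (3 * (2 * (L.card / 2000 + 1))) < p := by
    have h1 := Nat.sqrt_le' (3 * (2 * (L.card / 2000 + 1)))
    have h2 : 36 * (3 * (2 * (L.card / 2000 + 1))) < p ^ 2 := by omega
    refine lt_of_pow_lt_pow_left₀ 2 (Nat.zero_le _) ?_
    rw [mul_pow]; omega
  have h := edges_le_of_card_le_mul (J := 2000) (N := L.card / 2000 + 1) hQ
    (fun j h1 h2 => hchar j h1 (h2.trans_lt hs)) L (by omega) (by omega)
  refine h.trans ?_
  have h3 : Nat.sqrt (3 * (2 * (L.card / 2000 + 1))) ≤ Nat.sqrt (6 * L.card) :=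
    Nat.sqrt_le_sqrt (by omega)
  calc 2000 ^ 2 * (2 * (L.card / 2000 + 1) *
        (2 * (15 * Nat.sqrt (3 * (2 * (L.card / 2000 + 1))) + k)))
      ≤ 2000 ^ 2 * (2 * L.card * (2 * (15 * Nat.sqrt (6 * L.card) + k))) := by gcongr
    _ = 16000000 * (L.card * (15 * Nat.sqrt (6 * L.card) + k)) := by ring

end RaySystem

end RaySplitting

section BilinearRelations

open Polynomial

lemma exists_forall_eval_ne_zero {E σ : Type*} [Field E] [Infinite E] (s : Finset σ)
    (f : σ → E[X]) (hf : ∀ k ∈ s, f k ≠ 0) : ∃ x, ∀ k ∈ s, (f k).eval x ≠ 0 := by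
  classical
  obtain ⟨x, hx⟩ := Infinite.exists_notMem_finset (s.biUnion fun k => (f k).roots.toFinset)
  refine ⟨x, fun k hk h => hx ?_⟩
  rw [Finset.mem_biUnion]
  exact ⟨k, hk, by rw [Multiset.mem_toFinset, mem_roots (hf k hk)]; exact h⟩

/-- A shift for which the first-order obstruction to distinct meeting points is nonzero. -/
lemma exists_generic_shift {E κ : Type*} [Field E] [Infinite E] (s : Finset κ)
    (α w β z : κ → E) : ∃ δ : E, ∀ q ∈ s, ∀ q₁ ∈ s, ∀ q₂ ∈ s, β q₁ ≠ β q₂ →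
      α q * (z q₁ - z q₂) - (w q + δ) * (β q₁ - β q₂) ≠ 0 := by
  classical
  obtain ⟨δ, hδ⟩ := exists_forall_eval_ne_zero
    ((s ×ˢ s ×ˢ s).filter fun q => β q.2.1 ≠ β q.2.2)
    (fun q => C (α q.1 * (z q.2.1 - z q.2.2)) - (C (w q.1) + X) * C (β q.2.1 - β q.2.2)) (by
      rintro ⟨q, q₁, q₂⟩ hq h0
      have hne := (Finset.mem_filter.1 hq).2
      have := congrArg (fun f => f.coeff 1) h0
      simp only [coeff_sub, coeff_mul_C, coeff_add, coeff_X_one, coeff_C,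
        coeff_zero] at this
      simp only [one_ne_zero, if_false, zero_sub, zero_add, one_mul, neg_eq_zero] at this
      exact hne (sub_eq_zero.1 this))
  refine ⟨δ, fun q hq q₁ h₁ q₂ h₂ hne => ?_⟩
  have := hδ (q, q₁, q₂) (by simp [hq, h₁, h₂, hne])
  simpa using this

/-- A scaling for which distinct lines of the same kind meet a common line in distinct points. -/
lemma exists_generic_scale {E κ : Type*} [Field E] [Infinite E] (s : Finset κ)
    (α w β z : κ → E) (hα : ∀ q ∈ s, α q ≠ 0) :
    ∃ μ : E, μ ≠ 0 ∧ (∀ q ∈ s, ∀ q' ∈ s, α q ≠ μ * β q') ∧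
      (∀ q ∈ s, ∀ q₁ ∈ s, ∀ q₂ ∈ s, α q * (z q₁ - z q₂) - w q * (β q₁ - β q₂) ≠ 0 →
        (μ * z q₁ - w q) * (μ * β q₂ - α q) ≠ (μ * z q₂ - w q) * (μ * β q₁ - α q)) ∧
      (∀ q' ∈ s, ∀ q₁ ∈ s, ∀ q₂ ∈ s, β q' * (w q₁ - w q₂) - z q' * (α q₁ - α q₂) ≠ 0 →
        (w q₁ - μ * z q') * (α q₂ - μ * β q') ≠ (w q₂ - μ * z q') * (α q₁ - μ * β q')) := by
  classical
  obtain ⟨μ, hμ⟩ := exists_forall_eval_ne_zero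
    ((s ×ˢ s ×ˢ s).disjSum ((s ×ˢ s ×ˢ s).disjSum ((s ×ˢ s).disjSum {()})))
    (Sum.elim
      (fun q => if α q.1 * (z q.2.1 - z q.2.2) - w q.1 * (β q.2.1 - β q.2.2) = 0 then 1 else
        C (z q.2.1 * β q.2.2 - z q.2.2 * β q.2.1) * X ^ 2
        - C (α q.1 * (z q.2.1 - z q.2.2) - w q.1 * (β q.2.1 - β q.2.2)) * X)
      (Sum.elim
        (fun q => if β q.1 * (w q.2.1 - w q.2.2) - z q.1 * (α q.2.1 - α q.2.2) = 0 then 1 else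
          C (w q.2.1 * α q.2.2 - w q.2.2 * α q.2.1)
          - C (β q.1 * (w q.2.1 - w q.2.2) - z q.1 * (α q.2.1 - α q.2.2)) * X)
        (Sum.elim (fun q => C (α q.1) - C (β q.2) * X) (fun _ => X)))) (by
      rintro (⟨q, q₁, q₂⟩ | ⟨q, q₁, q₂⟩ | ⟨q, q'⟩ | ⟨⟩) hq
      · simp only [Sum.elim_inl]
        split_ifs with h
        · exact one_ne_zero
        · intro h0
          have := congrArg (fun f => f.coeff 1) h0
          simp only [coeff_sub, coeff_C_mul, coeff_X_one, coeff_X_pow, coeff_zero] at this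
          exact h (by rw [← neg_sub, neg_eq_zero]; simpa using this)
      · simp only [Sum.elim_inl, Sum.elim_inr]
        split_ifs with h
        · exact one_ne_zero
        · intro h0
          have := congrArg (fun f => f.coeff 1) h0
          simp only [coeff_sub, coeff_C_mul, coeff_X_one, coeff_C, coeff_zero] at this
          exact h (by rw [← neg_sub, neg_eq_zero]; simpa using this)
      · simp only [Sum.elim_inl, Sum.elim_inr]
        intro h0
        have := congrArg (fun f => f.coeff 0) h0
        simp only [coeff_sub, coeff_C_mul, coeff_X_zero, coeff_C_zero, coeff_zero, mul_zero,
          sub_zero] at this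
        simp only [Finset.inr_mem_disjSum, Finset.inl_mem_disjSum, Finset.mem_product] at hq
        exact hα q hq.1 this
      · simp only [Sum.elim_inr]
        exact X_ne_zero)
  refine ⟨μ, ?_, ?_, ?_, ?_⟩
  · simpa using hμ (Sum.inr (Sum.inr (Sum.inr ()))) (by simp)
  · intro q hq q' hq' h
    have := hμ (Sum.inr (Sum.inr (Sum.inl (q, q')))) (by simp [hq, hq'])
    simp only [Sum.elim_inl, Sum.elim_inr, eval_sub, eval_mul, eval_C, eval_X] at this
    exact this (by rw [h]; ring)
  · intro q hq q₁ h₁ q₂ h₂ hne h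
    have := hμ (Sum.inl (q, q₁, q₂)) (by simp [hq, h₁, h₂])
    simp only [Sum.elim_inl, hne, if_false, eval_sub, eval_mul, eval_C, eval_X, eval_pow] at this
    exact this (by linear_combination h)
  · intro q hq q₁ h₁ q₂ h₂ hne h
    have := hμ (Sum.inr (Sum.inl (q, q₁, q₂))) (by simp [hq, h₁, h₂])
    simp only [Sum.elim_inl, Sum.elim_inr, hne, if_false, eval_sub, eval_mul, eval_C,
      eval_X] at this
    exact this (by linear_combination h)

open Classical in
/-- The number of solutions of `β q' (y q' - w q) + α q (z q' - x q) = 0` in a finite set on which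
this bilinear relation is nondegenerate. -/
theorem card_bilinear_le {E κ : Type*} [Field E] [Infinite E] (s : Finset κ)
    (α w x β z y : κ → E) {k p : ℕ} (hα : ∀ q ∈ s, α q ≠ 0) (hβ : ∀ q ∈ s, β q ≠ 0)
    (hinjα : ∀ q ∈ s, ∀ q' ∈ s, α q = α q' → w q = w q' → x q = x q' → q = q')
    (hinjβ : ∀ q ∈ s, ∀ q' ∈ s, β q = β q' → z q = z q' → y q = y q' → q = q')
    (hQα : ∀ q' ∈ s, ∀ P Q R : E, P ≠ 0 ∨ Q ≠ 0 → (s.filter fun q =>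
      P * α q + Q * w q = R ∧ β q' * (y q' - w q) + α q * (z q' - x q) = 0).card ≤ k)
    (hQβ : ∀ q ∈ s, ∀ P Q R : E, P ≠ 0 ∨ Q ≠ 0 → (s.filter fun q' =>
      P * β q' + Q * z q' = R ∧ β q' * (y q' - w q) + α q * (z q' - x q) = 0).card ≤ k)
    (hp : 30 ≤ p) (hchar : ∀ j : ℕ, 0 < j → j < p → (j : E) ≠ 0) (hs : s.card ≤ 3 * p ^ 2) :
    ((s ×ˢ s).filter fun q =>
        β q.2 * (y q.2 - w q.1) + α q.1 * (z q.2 - x q.1) = 0).card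
      ≤ 16000000 * (2 * s.card * (15 * Nat.sqrt (12 * s.card) + k)) := by
  obtain ⟨δ₂, hδ₂⟩ := exists_generic_shift s α w β z
  obtain ⟨δ₁, hδ₁⟩ := exists_generic_shift s β z α w
  obtain ⟨μ, hμ0, hμ1, hμ2, hμ3⟩ := exists_generic_scale s α (fun q => w q + δ₂) β
    (fun q => z q + δ₁) hα
  let rel : κ → κ → Prop := fun q q' => q ∈ s ∧ q' ∈ s ∧
    β q' * (y q' - w q) + α q * (z q' - x q) = 0
  let S : RaySystem E (κ ⊕ κ) :=
    { t := Sum.elim α fun q => μ * β q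
      b := Sum.elim (fun q => -(w q + δ₂)) fun q => -(μ * (z q + δ₁))
      c := Sum.elim (fun q => μ * (x q + δ₁) * α q + α q * -(w q + δ₂))
        fun q => μ * β q * (y q + δ₂) + μ * β q * -(μ * (z q + δ₁))
      adj := fun i j => Sum.elim (fun q => Sum.elim (fun _ => False) (rel q) j)
        (fun q' => Sum.elim (fun q => rel q q') (fun _ => False) j) i
      symm := by
        rintro (q | q) (q' | q') h
        · exact h
        · exact h
        · exact h
        · exact h
      ne := by
        rintro (q | q) (q' | q') h
        · exact h.elim
        · exact hμ1 q h.1 q' h.2.1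
        · exact (hμ1 q' h.1 q h.2.1).symm
        · exact h.elim
      meet := by
        rintro (q | q) (q' | q') h
        · exact h.elim
        · have := h.2.2
          simp only [Sum.elim_inl, Sum.elim_inr]
          linear_combination -μ * this
        · have := h.2.2
          simp only [Sum.elim_inl, Sum.elim_inr]
          linear_combination μ * this
        · exact h.elim
      inj := by
        rintro (q | q) (q₁ | q₁) (q₂ | q₂) h1 h2 h
        · exact h1.elim
        · exact h1.elim
        · exact h2.elim
        · simp only [Sum.elim_inl, Sum.elim_inr] at h1 h2 h
          obtain ⟨hq, hq₁, e1⟩ := h1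
          obtain ⟨-, hq₂, e2⟩ := h2
          rw [div_eq_div_iff (sub_ne_zero.2 (hμ1 q hq q₁ hq₁).symm)
            (sub_ne_zero.2 (hμ1 q hq q₂ hq₂).symm)] at h
          by_contra hne
          refine hμ2 q hq q₁ hq₁ q₂ hq₂ ?_ (by linear_combination h)
          rw [add_sub_add_right_eq_sub]
          by_cases hb : β q₁ = β q₂
          · rw [hb, sub_self, mul_zero, sub_zero]
            refine mul_ne_zero (hα q hq) (sub_ne_zero.2 fun hz => hne ?_)
            rw [hb, hz] at e1
            congr 1
            refine hinjβ q₁ hq₁ q₂ hq₂ hb hz (mul_left_cancel₀ (hβ q₂ hq₂) ?_)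
            linear_combination e1 - e2
          · exact hδ₂ q hq q₁ hq₁ q₂ hq₂ hb
        · simp only [Sum.elim_inl, Sum.elim_inr] at h1 h2 h
          obtain ⟨hq₁, hq, e1⟩ := h1
          obtain ⟨hq₂, -, e2⟩ := h2
          rw [div_eq_div_iff (sub_ne_zero.2 (hμ1 q₁ hq₁ q hq))
            (sub_ne_zero.2 (hμ1 q₂ hq₂ q hq))] at h
          by_contra hne
          refine hμ3 q hq q₁ hq₁ q₂ hq₂ ?_ (by linear_combination h)
          rw [add_sub_add_right_eq_sub]
          by_cases hb : α q₁ = α q₂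
          · rw [hb, sub_self, mul_zero, sub_zero]
            refine mul_ne_zero (hβ q hq) (sub_ne_zero.2 fun hz => hne ?_)
            rw [hb, hz] at e1
            congr 1
            refine hinjα q₁ hq₁ q₂ hq₂ hb hz (mul_left_cancel₀ (hα q₂ hq₂) ?_)
            linear_combination e2 - e1
          · exact hδ₁ q hq q₁ hq₁ q₂ hq₂ hb
        · exact h2.elim
        · exact h1.elim
        · exact h1.elim }
  have hQ : S.QuadricBound k := by
    intro L i A B
    by_cases hAB : A = 0 ∧ B = 0
    · simp [hAB]
    have hAB' : A ≠ 0 ∨ B ≠ 0 := by tauto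
    rcases i with q | q'
    · by_cases hq : q ∈ s
      · refine le_trans ?_ (hQβ q hq (A * μ) (B * μ)
          (1 + A * α q + B * (w q + δ₂) - B * μ * δ₁) (by simpa [hμ0] using hAB'))
        refine Finset.card_le_card_of_injOn (Sum.elim id id) ?_ ?_
        · rintro (q' | q') hj
          · obtain ⟨hj, -⟩ := Finset.mem_filter.1 hj
            exact (S.mem_nbr.1 hj).2.elim
          · obtain ⟨hj, e⟩ := Finset.mem_filter.1 hj
            obtain ⟨-, hq', e1⟩ := (S.mem_nbr.1 hj).2
            simp only [S, Sum.elim_inl, Sum.elim_inr] at e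
            simp only [Finset.coe_filter, Set.mem_ofPred_eq, Sum.elim_inr, id]
            exact ⟨hq', by linear_combination e, e1⟩
        · rintro (q₁ | q₁) h1 (q₂ | q₂) h2 h
          · exact congrArg _ h
          · exact (S.mem_nbr.1 (Finset.mem_filter.1 h1).1).2.elim
          · exact (S.mem_nbr.1 (Finset.mem_filter.1 h2).1).2.elim
          · exact congrArg _ h
      · refine le_trans (le_of_eq ?_) (Nat.zero_le k)
        rw [Finset.card_eq_zero, Finset.filter_eq_empty_iff]
        rintro (q' | q') hj
        · exact (S.mem_nbr.1 hj).2.elim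
        · exact (hq (S.mem_nbr.1 hj).2.1).elim
    · by_cases hq : q' ∈ s
      · refine le_trans ?_ (hQα q' hq A B
          (1 + A * (μ * β q') + B * (μ * (z q' + δ₁)) - B * δ₂) hAB')
        refine Finset.card_le_card_of_injOn (Sum.elim id id) ?_ ?_
        · rintro (q | q) hj
          · obtain ⟨hj, e⟩ := Finset.mem_filter.1 hj
            obtain ⟨hq', -, e1⟩ := (S.mem_nbr.1 hj).2
            simp only [S, Sum.elim_inl, Sum.elim_inr] at e
            simp only [Finset.coe_filter, Set.mem_ofPred_eq, Sum.elim_inl, id]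
            exact ⟨hq', by linear_combination e, e1⟩
          · obtain ⟨hj, -⟩ := Finset.mem_filter.1 hj
            exact (S.mem_nbr.1 hj).2.elim
        · rintro (q₁ | q₁) h1 (q₂ | q₂) h2 h
          · exact congrArg _ h
          · exact (S.mem_nbr.1 (Finset.mem_filter.1 h2).1).2.elim
          · exact (S.mem_nbr.1 (Finset.mem_filter.1 h1).1).2.elim
          · exact congrArg _ h
      · refine le_trans (le_of_eq ?_) (Nat.zero_le k)
        rw [Finset.card_eq_zero, Finset.filter_eq_empty_iff]
        rintro (q | q) hj
        · exact (hq (S.mem_nbr.1 hj).2.2.1).elim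
        · exact (S.mem_nbr.1 hj).2.elim
  have hcard : (s.disjSum s).card = 2 * s.card := by rw [Finset.card_disjSum]; ring
  have h := RaySystem.edges_le_of_card_le_sq hQ hp hchar (s.disjSum s) (by omega)
  rw [hcard, show 6 * (2 * s.card) = 12 * s.card by ring] at h
  refine le_trans ?_ h
  unfold RaySystem.edges
  refine Finset.card_le_card_of_injOn (fun q => (Sum.inl q.1, Sum.inr q.2)) ?_ ?_
  · rintro ⟨q, q'⟩ hq
    simp only [Finset.coe_filter, Finset.mem_product, Set.mem_ofPred_eq] at hq
    simp only [Finset.coe_filter, Finset.mem_product, Set.mem_ofPred_eq,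
      Finset.inl_mem_disjSum, Finset.inr_mem_disjSum]
    exact ⟨hq.1, hq.1.1, hq.1.2, hq.2⟩
  · rintro ⟨q, q'⟩ - ⟨r, r'⟩ - h
    simp only [Prod.mk.injEq, Sum.inl.injEq, Sum.inr.injEq] at h
    exact Prod.ext h.1 h.2

end BilinearRelations

section NullCoordinates

variable {F E : Type*} [Field F] [Field E] [Algebra F E]

/-- The coordinate `x₁ + i x₂`; for `i² = -1` the coordinates for `i` and `-i` are null. -/
def nullCoord (i : E) (x : F × F) : E := algebraMap F E x.1 + i * algebraMap F E x.2

lemma nullCoord_mul {i : E} (hi : i ^ 2 = -1) (a b : F × F) :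
    (nullCoord i a - nullCoord i b) * (nullCoord (-i) a - nullCoord (-i) b)
      = algebraMap F E (dist2 a b) := by
  simp only [nullCoord, dist2, map_add, map_sub, map_pow]
  linear_combination -(algebraMap F E a.2 - algebraMap F E b.2) ^ 2 * hi

lemma algebraMap_two_ne_zero (h2 : (2 : F) ≠ 0) : (2 : E) ≠ 0 := by
  have := (map_ne_zero (algebraMap F E)).2 h2
  rwa [map_ofNat] at this

lemma nullCoord_ext {i : E} (hi : i ^ 2 = -1) (h2 : (2 : F) ≠ 0) {a b : F × F}
    (hu : nullCoord i a = nullCoord i b) (hv : nullCoord (-i) a = nullCoord (-i) b) : a = b := by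
  have h2' : (2 : E) ≠ 0 := algebraMap_two_ne_zero h2
  have hi0 : i ≠ 0 := by rintro rfl; norm_num at hi
  simp only [nullCoord] at hu hv
  refine Prod.ext ((algebraMap F E).injective ?_) ((algebraMap F E).injective ?_)
  · apply mul_left_cancel₀ h2'; linear_combination hu + hv
  · apply mul_left_cancel₀ (mul_ne_zero h2' hi0); linear_combination hu - hv

/-- At most `M` points of `A` lie on a common line or circle. -/
def AtMostOnCurves (A : Finset (F × F)) (M : ℕ) : Prop :=
  ∀ L : Set (F × F), IsLine L ∨ IsCircle L → ((A : Set (F × F)) ∩ L).ncard ≤ M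

variable {A : Finset (F × F)} {M : ℕ}

lemma isLine_setOf {a b : F} (g : F) (h : a ≠ 0 ∨ b ≠ 0) :
    IsLine {x : F × F | a * x.1 + b * x.2 = g} := by
  have hv : ((-b, a) : F × F) ≠ 0 := by
    rw [Ne, Prod.mk_eq_zero, neg_eq_zero]; tauto
  by_cases ha : a = 0
  · have hb : b ≠ 0 := by tauto
    refine ⟨(0, g / b), (-b, a), hv, Set.ext fun y => ⟨fun hy => ⟨-y.1 / b, ?_⟩, ?_⟩⟩
    · simp only [Set.mem_ofPred_eq, ha, zero_mul, zero_add] at hy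
      refine Prod.ext ?_ ?_
      · simp only [Prod.fst_add, Prod.smul_fst, smul_eq_mul]; field_simp; ring
      · simp only [Prod.snd_add, Prod.smul_snd, smul_eq_mul, ha, ← hy]; field_simp; ring
    · rintro ⟨t, rfl⟩
      simp only [Set.mem_ofPred_eq, ha, Prod.snd_add, Prod.smul_snd, smul_eq_mul]
      field_simp; ring
  · refine ⟨(g / a, 0), (-b, a), hv, Set.ext fun y => ⟨fun hy => ⟨y.2 / a, ?_⟩, ?_⟩⟩
    · simp only [Set.mem_ofPred_eq] at hy
      refine Prod.ext ?_ ?_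
      · simp only [Prod.fst_add, Prod.smul_fst, smul_eq_mul, ← hy]; field_simp; ring
      · simp only [Prod.snd_add, Prod.smul_snd, smul_eq_mul]; field_simp; ring
    · rintro ⟨t, rfl⟩
      simp only [Set.mem_ofPred_eq, Prod.fst_add, Prod.smul_fst, Prod.snd_add, Prod.smul_snd,
        smul_eq_mul]
      field_simp; ring

open Classical in
lemma AtMostOnCurves.card_filter_le (hA : AtMostOnCurves A M) {L : Set (F × F)}
    (hL : IsLine L ∨ IsCircle L) {p : F × F → Prop} (hp : ∀ x, p x → x ∈ L) :
    (A.filter p).card ≤ M := by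
  refine le_trans ?_ (hA L hL)
  rw [← Set.ncard_coe_finset]
  refine Set.ncard_le_ncard ?_ (A.finite_toSet.inter_of_left L)
  intro x hx
  have := Finset.mem_filter.1 (Finset.mem_coe.1 hx)
  exact ⟨this.1, hp x this.2⟩

open Classical in
lemma AtMostOnCurves.card_linear_le (hA : AtMostOnCurves A M) {p q : E} (g : E)
    (h : p ≠ 0 ∨ q ≠ 0) :
    (A.filter fun x => p * algebraMap F E x.1 + q * algebraMap F E x.2 = g).card ≤ M := by
  obtain ⟨π, hπ⟩ : ∃ π : Module.Dual F E, π p ≠ 0 ∨ π q ≠ 0 := by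
    rcases h with h | h
    · rw [Ne, ← Module.forall_dual_apply_eq_zero_iff F p] at h
      push Not at h
      exact h.imp fun _ => Or.inl
    · rw [Ne, ← Module.forall_dual_apply_eq_zero_iff F q] at h
      push Not at h
      exact h.imp fun _ => Or.inr
  refine hA.card_filter_le (Or.inl (isLine_setOf (π g) hπ)) fun x hx => ?_
  have := congrArg π hx
  rw [map_add, mul_comm p, mul_comm q, ← Algebra.smul_def, ← Algebra.smul_def, map_smul,
    map_smul, smul_eq_mul, smul_eq_mul] at this
  rw [Set.mem_ofPred_eq, ← this]; ring

open Classical in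
lemma AtMostOnCurves.card_nullCoord_le (hA : AtMostOnCurves A M) {i : E} (hi : i ^ 2 = -1)
    (h2 : (2 : F) ≠ 0) {p q : E} (g : E) (h : p ≠ 0 ∨ q ≠ 0) :
    (A.filter fun x => p * nullCoord i x + q * nullCoord (-i) x = g).card ≤ M := by
  have h2' : (2 : E) ≠ 0 := algebraMap_two_ne_zero h2
  have hi0 : i ≠ 0 := by rintro rfl; norm_num at hi
  have hpq : p + q ≠ 0 ∨ i * (p - q) ≠ 0 := by
    by_contra! hc
    have h1 := (mul_eq_zero.1 hc.2).resolve_left hi0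
    have hp : p = 0 := by apply mul_left_cancel₀ h2'; linear_combination hc.1 + h1
    have hq : q = 0 := by apply mul_left_cancel₀ h2'; linear_combination hc.1 - h1
    tauto
  refine le_trans (Finset.card_le_card fun x hx => ?_) (hA.card_linear_le g hpq)
  rw [Finset.mem_filter] at hx ⊢
  refine ⟨hx.1, ?_⟩
  rw [← hx.2, nullCoord, nullCoord]; ring

open Classical in
lemma AtMostOnCurves.card_circle_le (hA : AtMostOnCurves A M) {i : E} (hi : i ^ 2 = -1)
    (h2 : (2 : F) ≠ 0) (c : F × F) (r : F) :
    (A.filter fun x => dist2 x c = r).card ≤ 2 * M := by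
  by_cases hr : r = 0
  · have h1 := hA.card_nullCoord_le hi h2 (p := 1) (q := 0) (nullCoord i c) (by simp)
    have h3 := hA.card_nullCoord_le hi h2 (p := 0) (q := 1) (nullCoord (-i) c) (by simp)
    rw [two_mul]
    refine le_trans (Finset.card_le_card fun x hx => ?_)
      ((Finset.card_union_le _ _).trans (add_le_add h1 h3))
    rw [Finset.mem_filter] at hx
    rw [Finset.mem_union, Finset.mem_filter, Finset.mem_filter]
    have h4 := nullCoord_mul hi x c
    rw [hx.2, hr, map_zero, mul_eq_zero, sub_eq_zero, sub_eq_zero] at h4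
    rcases h4 with h4 | h4
    · exact Or.inl ⟨hx.1, by rw [h4]; ring⟩
    · exact Or.inr ⟨hx.1, by rw [h4]; ring⟩
  · exact (hA.card_filter_le (Or.inr ⟨c, r, hr, rfl⟩) fun x hx => hx).trans (by omega)

open Classical in
lemma AtMostOnCurves.card_conic_le (hA : AtMostOnCurves A M) {i : E} (hi : i ^ 2 = -1)
    (h2 : (2 : F) ≠ 0) (p q g : E) :
    (A.filter fun x => nullCoord i x * nullCoord (-i) x + p * nullCoord i x
      + q * nullCoord (-i) x = g).card ≤ 2 * M := by
  obtain ⟨π, hπ⟩ : ∃ π : Module.Dual F E, π 1 ≠ 0 := by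
    have h := one_ne_zero (α := E)
    rw [Ne, ← Module.forall_dual_apply_eq_zero_iff F (1 : E)] at h
    push Not at h
    exact h
  obtain ⟨a, ha⟩ : ∃ a, a = π (p + q) / π 1 := ⟨_, rfl⟩
  obtain ⟨b, hb⟩ : ∃ b, b = π (i * (p - q)) / π 1 := ⟨_, rfl⟩
  refine le_trans (Finset.card_le_card fun x hx => ?_)
    (hA.card_circle_le hi h2 (-a / 2, -b / 2) (π g / π 1 + (a ^ 2 + b ^ 2) / 4))
  rw [Finset.mem_filter] at hx ⊢
  refine ⟨hx.1, ?_⟩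
  have h1 : algebraMap F E (x.1 ^ 2 + x.2 ^ 2) * 1 + algebraMap F E x.1 * (p + q)
      + algebraMap F E x.2 * (i * (p - q)) = g := by
    rw [← hx.2, nullCoord, nullCoord, map_add, map_pow, map_pow]
    linear_combination (algebraMap F E x.2) ^ 2 * hi
  have h3 := congrArg π h1
  rw [map_add, map_add, ← Algebra.smul_def, ← Algebra.smul_def, ← Algebra.smul_def, map_smul,
    map_smul, map_smul, smul_eq_mul, smul_eq_mul, smul_eq_mul] at h3
  have ha' : π (p + q) = a * π 1 := by rw [ha]; field_simp
  have hb' : π (i * (p - q)) = b * π 1 := by rw [hb]; field_simp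
  have h4 : (4 : F) ≠ 0 := by
    have : (4 : F) = 2 * 2 := by norm_num
    rw [this]; exact mul_ne_zero h2 h2
  have h5 : π g / π 1 = x.1 ^ 2 + x.2 ^ 2 + a * x.1 + b * x.2 := by
    rw [← h3, ha', hb']; field_simp
  rw [h5, dist2]
  have h6 : (2 : F) * 2 = 4 := by norm_num
  field_simp
  ring

end NullCoordinates

section PairsAtDistance

variable {F E : Type*} [Field F] [Field E] [Algebra F E] {A : Finset (F × F)} {M : ℕ} {r : F}

open Classical in
/-- The ordered pairs of points of `A` at distance `r`. -/
noncomputable def pairsAt (A : Finset (F × F)) (r : F) : Finset ((F × F) × (F × F)) :=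
  (A ×ˢ A).filter fun q => dist2 q.1 q.2 = r

lemma mem_pairsAt {q : (F × F) × (F × F)} :
    q ∈ pairsAt A r ↔ (q.1 ∈ A ∧ q.2 ∈ A) ∧ dist2 q.1 q.2 = r := by
  classical
  simp only [pairsAt, Finset.mem_filter, Finset.mem_product]

lemma nullCoord_sub_ne_zero {i : E} (hi : i ^ 2 = -1) (hr : r ≠ 0) {q : (F × F) × (F × F)}
    (hq : q ∈ pairsAt A r) : nullCoord i q.1 - nullCoord i q.2 ≠ 0 := by
  have h := nullCoord_mul hi q.1 q.2
  rw [(mem_pairsAt.1 hq).2] at h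
  exact left_ne_zero_of_mul (h.trans_ne ((map_ne_zero _).2 hr))

lemma pairsAt_ext {i : E} (hi : i ^ 2 = -1) (h2 : (2 : F) ≠ 0) (hr : r ≠ 0)
    {q q' : (F × F) × (F × F)} (hq : q ∈ pairsAt A r) (hq' : q' ∈ pairsAt A r)
    (hβ : nullCoord i q.1 - nullCoord i q.2 = nullCoord i q'.1 - nullCoord i q'.2)
    (h : q.1 = q'.1) : q = q' := by
  refine Prod.ext h (nullCoord_ext hi h2 ?_ ?_)
  · rw [h] at hβ; linear_combination -hβ
  · apply mul_left_cancel₀ (nullCoord_sub_ne_zero hi hr hq)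
    have h3 := nullCoord_mul hi q.1 q.2
    have h4 := nullCoord_mul hi q'.1 q'.2
    rw [(mem_pairsAt.1 hq).2] at h3
    rw [(mem_pairsAt.1 hq').2, ← hβ, ← h] at h4
    linear_combination h4 - h3

open Classical in
lemma AtMostOnCurves.card_pairs_linear_le (hA : AtMostOnCurves A M) {i : E} (hi : i ^ 2 = -1)
    (h2 : (2 : F) ≠ 0) (hr : r ≠ 0) {α : E} (hα : α ≠ 0) (U V : E) {P Q : E} (R : E)
    (hPQ : P ≠ 0 ∨ Q ≠ 0) :
    ((pairsAt A r).filter fun q =>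
      P * (nullCoord i q.1 - nullCoord i q.2) + Q * nullCoord i q.1 = R ∧
      (nullCoord i q.1 - nullCoord i q.2) * (nullCoord (-i) q.1 - V)
        + α * (nullCoord i q.1 - U) = 0).card ≤ 2 * M := by
  by_cases hQ : Q = 0
  · have hP : P ≠ 0 := by tauto
    have hdet : ∀ q : (F × F) × (F × F), P * (nullCoord i q.1 - nullCoord i q.2)
        + Q * nullCoord i q.1 = R → nullCoord i q.1 - nullCoord i q.2 = R / P := by
      intro q h
      rw [← h, hQ]; field_simp; ring
    refine le_trans ?_ ((hA.card_nullCoord_le hi h2 (q := R / P) (R / P * V + α * U)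
      (Or.inl hα)).trans (by omega : M ≤ 2 * M))
    refine Finset.card_le_card_of_injOn Prod.fst ?_ ?_
    · intro q hq
      obtain ⟨hq, h1, h3⟩ := Finset.mem_filter.1 (Finset.mem_coe.1 hq)
      rw [Finset.mem_coe, Finset.mem_filter]
      refine ⟨(mem_pairsAt.1 hq).1.1, ?_⟩
      rw [hdet q h1] at h3
      linear_combination h3
    · intro q hq q' hq' h
      obtain ⟨hq, h1, -⟩ := Finset.mem_filter.1 (Finset.mem_coe.1 hq)
      obtain ⟨hq', h1', -⟩ := Finset.mem_filter.1 (Finset.mem_coe.1 hq')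
      exact pairsAt_ext hi h2 hr hq hq' ((hdet q h1).trans (hdet q' h1').symm) h
  by_cases hP : P = 0
  · have hcard1 : ((pairsAt A r).filter fun q =>
        nullCoord i q.1 = R / Q ∧ nullCoord (-i) q.1 = V).card ≤ M := by
      rcases Finset.eq_empty_or_nonempty ((pairsAt A r).filter fun q =>
        nullCoord i q.1 = R / Q ∧ nullCoord (-i) q.1 = V) with h0 | ⟨q₀, h0⟩
      · rw [h0]; simp
      · have hq₀ := (Finset.mem_filter.1 h0).2
        have hfst : ∀ q ∈ (pairsAt A r).filter fun q =>
            nullCoord i q.1 = R / Q ∧ nullCoord (-i) q.1 = V, q.1 = q₀.1 := by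
          intro q hq
          have hq := (Finset.mem_filter.1 hq).2
          exact nullCoord_ext hi h2 (hq.1.trans hq₀.1.symm) (hq.2.trans hq₀.2.symm)
        refine le_trans ?_ (hA.card_filter_le (p := fun x => dist2 x q₀.1 = r)
          (Or.inr ⟨q₀.1, r, hr, rfl⟩) fun x hx => hx)
        refine Finset.card_le_card_of_injOn Prod.snd ?_ ?_
        · intro q hq
          rw [Finset.mem_coe] at hq
          have h1 := hfst q hq
          obtain ⟨h3, h4⟩ := mem_pairsAt.1 (Finset.mem_filter.1 hq).1
          rw [Finset.mem_coe, Finset.mem_filter]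
          refine ⟨h3.2, ?_⟩
          rw [← h4, h1, dist2, dist2]; ring
        · intro q hq q' hq' h
          rw [Finset.mem_coe] at hq hq'
          exact Prod.ext ((hfst q hq).trans (hfst q' hq').symm) h
    have hcard2 : ((pairsAt A r).filter fun q => Q * nullCoord i q.1 = R ∧
        (nullCoord i q.1 - nullCoord i q.2) * (nullCoord (-i) q.1 - V)
          + α * (nullCoord i q.1 - U) = 0 ∧ nullCoord (-i) q.1 ≠ V).card ≤ M := by
      refine le_trans ?_ (hA.card_nullCoord_le hi h2 (q := 0) R (Or.inl hQ))
      refine Finset.card_le_card_of_injOn Prod.fst ?_ ?_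
      · intro q hq
        obtain ⟨hq, h1, -⟩ := Finset.mem_filter.1 (Finset.mem_coe.1 hq)
        rw [Finset.mem_coe, Finset.mem_filter]
        exact ⟨(mem_pairsAt.1 hq).1.1, by rw [zero_mul, add_zero]; exact h1⟩
      · intro q hq q' hq' h
        obtain ⟨hq, -, h3, h4⟩ := Finset.mem_filter.1 (Finset.mem_coe.1 hq)
        obtain ⟨hq', -, h3', -⟩ := Finset.mem_filter.1 (Finset.mem_coe.1 hq')
        refine pairsAt_ext hi h2 hr hq hq' ?_ h
        apply mul_right_cancel₀ (sub_ne_zero.2 h4)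
        rw [← h] at h3' ⊢
        linear_combination h3 - h3'
    rw [two_mul]
    refine le_trans (Finset.card_le_card fun q hq => ?_)
      ((Finset.card_union_le _ _).trans (add_le_add hcard1 hcard2))
    obtain ⟨hq, h1, h3⟩ := Finset.mem_filter.1 hq
    rw [hP, zero_mul, zero_add] at h1
    rw [Finset.mem_union, Finset.mem_filter, Finset.mem_filter]
    by_cases h4 : nullCoord (-i) q.1 = V
    · exact Or.inl ⟨hq, by rw [← h1]; field_simp, h4⟩
    · exact Or.inr ⟨hq, h1, h3, h4⟩
  · refine le_trans ?_ (hA.card_conic_le hi h2 (-(V + α * P / Q)) (-(R / Q))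
      (-((R * V + α * P * U) / Q)))
    refine Finset.card_le_card_of_injOn Prod.fst ?_ ?_
    · intro q hq
      obtain ⟨hq, h1, h3⟩ := Finset.mem_filter.1 (Finset.mem_coe.1 hq)
      rw [Finset.mem_coe, Finset.mem_filter]
      refine ⟨(mem_pairsAt.1 hq).1.1, ?_⟩
      apply mul_left_cancel₀ hQ
      have e1 : Q * (α * P / Q) = α * P := by field_simp
      have e2 : Q * (R / Q) = R := by field_simp
      have e3 : Q * ((R * V + α * P * U) / Q) = R * V + α * P * U := by field_simp
      linear_combination (nullCoord (-i) q.1 - V) * h1 - P * h3 - nullCoord i q.1 * e1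
        - nullCoord (-i) q.1 * e2 + e3
    · intro q hq q' hq' h
      obtain ⟨hq, h1, -⟩ := Finset.mem_filter.1 (Finset.mem_coe.1 hq)
      obtain ⟨hq', h1', -⟩ := Finset.mem_filter.1 (Finset.mem_coe.1 hq')
      refine pairsAt_ext hi h2 hr hq hq' ?_ h
      apply mul_left_cancel₀ hP
      rw [← h] at h1' ⊢
      linear_combination h1 - h1'

open Classical in
/-- The number of pairs in `pairsAt A r` related by the null-coordinate form of the bisector
condition. -/
lemma AtMostOnCurves.card_related_pairs_le [Infinite E] (hA : AtMostOnCurves A M) {i : E}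
    (hi : i ^ 2 = -1) (h2 : (2 : F) ≠ 0) (hr : r ≠ 0) {p : ℕ} (hp : 30 ≤ p)
    (hchar : ∀ j : ℕ, 0 < j → j < p → (j : F) ≠ 0) (hs : (pairsAt A r).card ≤ 3 * p ^ 2) :
    ((pairsAt A r ×ˢ pairsAt A r).filter fun q =>
      (nullCoord i q.2.1 - nullCoord i q.2.2) * (nullCoord (-i) q.2.1 - nullCoord (-i) q.1.1)
      + (nullCoord (-i) q.1.1 - nullCoord (-i) q.1.2) * (nullCoord i q.2.1 - nullCoord i q.1.1)
        = 0).card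
      ≤ 16000000 * (2 * (pairsAt A r).card
        * (15 * Nat.sqrt (12 * (pairsAt A r).card) + 2 * M)) := by
  have hi' : (-i) ^ 2 = -1 := by rw [neg_sq, hi]
  refine card_bilinear_le (pairsAt A r)
    (fun q => nullCoord (-i) q.1 - nullCoord (-i) q.2) (fun q => nullCoord (-i) q.1)
    (fun q => nullCoord i q.1) (fun q => nullCoord i q.1 - nullCoord i q.2)
    (fun q => nullCoord i q.1) (fun q => nullCoord (-i) q.1)
    (fun q hq => nullCoord_sub_ne_zero hi' hr hq) (fun q hq => nullCoord_sub_ne_zero hi hr hq)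
    (fun q hq q' hq' h1 h3 h4 => pairsAt_ext hi' h2 hr hq hq' h1 (nullCoord_ext hi h2 h4 h3))
    (fun q hq q' hq' h1 h3 h4 => pairsAt_ext hi h2 hr hq hq' h1 (nullCoord_ext hi h2 h3 h4))
    ?_ ?_ hp ?_ hs
  · intro q' hq' P Q R hPQ
    refine le_trans (Finset.card_le_card fun q hq => ?_) (hA.card_pairs_linear_le hi' h2 hr
      (nullCoord_sub_ne_zero hi hr hq') (nullCoord (-i) q'.1) (nullCoord i q'.1) R hPQ)
    rw [Finset.mem_filter] at hq ⊢
    refine ⟨hq.1, hq.2.1, ?_⟩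
    rw [neg_neg]
    linear_combination -hq.2.2
  · intro q hq P Q R hPQ
    exact hA.card_pairs_linear_le hi h2 hr
      (nullCoord_sub_ne_zero hi' hr hq) (nullCoord i q.1) (nullCoord (-i) q.1) R hPQ
  · intro j hj hjp
    have := (map_ne_zero (algebraMap F E)).2 (hchar j hj hjp)
    rwa [map_natCast] at this

end PairsAtDistance

section CirclePairCount

variable {F E : Type*} [Field F] [Field E] [Algebra F E] {A : Finset (F × F)} {M : ℕ} {r : F}

lemma dist2_comm (a b : F × F) : dist2 a b = dist2 b a := by
  rw [dist2, dist2]; ring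

open Classical in
lemma card_two_circles_le (A : Finset (F × F)) {i : E} (hi : i ^ 2 = -1) (h2 : (2 : F) ≠ 0)
    (hr : r ≠ 0) {b c : F × F} (hbc : b ≠ c) :
    (A.filter fun x => dist2 x b = r ∧ dist2 x c = r).card ≤ 2 := by
  have hρ : algebraMap F E r ≠ 0 := (map_ne_zero _).2 hr
  have hb : ∀ x, dist2 x b = r → (nullCoord i x - nullCoord i b)
      * (nullCoord (-i) x - nullCoord (-i) b) = algebraMap F E r := fun x hx => by
    rw [nullCoord_mul hi, hx]
  have hc : ∀ x, dist2 x c = r → (nullCoord i x - nullCoord i c)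
      * (nullCoord (-i) x - nullCoord (-i) c) = algebraMap F E r := fun x hx => by
    rw [nullCoord_mul hi, hx]
  obtain ⟨D, hD⟩ : ∃ D, D = nullCoord (-i) b - nullCoord (-i) c := ⟨_, rfl⟩
  obtain ⟨P, hP⟩ : ∃ P : Polynomial E, P = Polynomial.C D * Polynomial.X ^ 2
      + Polynomial.C (-D * (nullCoord i b + nullCoord i c)) * Polynomial.X
      + Polynomial.C (D * nullCoord i b * nullCoord i c
        + algebraMap F E r * (nullCoord i b - nullCoord i c)) := ⟨_, rfl⟩
  have hP0 : P ≠ 0 := by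
    intro h0
    have hc2 := congrArg (fun Q => Polynomial.coeff Q 2) h0
    have hc0 := congrArg (fun Q => Polynomial.coeff Q 0) h0
    simp [hP] at hc2
    simp [hP, hc2, sub_eq_zero, hρ] at hc0
    exact hbc (nullCoord_ext hi h2 hc0 (sub_eq_zero.1 (hD.symm.trans hc2)))
  have hdeg : P.natDegree ≤ 2 := hP ▸ Polynomial.natDegree_quadratic_le
  refine le_trans ?_ ((Multiset.toFinset_card_le _).trans ((Polynomial.card_roots' P).trans hdeg))
  refine Finset.card_le_card_of_injOn (nullCoord i) ?_ ?_
  · intro x hx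
    obtain ⟨-, h1, h3⟩ := Finset.mem_filter.1 (Finset.mem_coe.1 hx)
    rw [Finset.mem_coe, Multiset.mem_toFinset, Polynomial.mem_roots hP0, Polynomial.IsRoot, hP]
    simp only [Polynomial.eval_add, Polynomial.eval_mul, Polynomial.eval_C, Polynomial.eval_pow,
      Polynomial.eval_X]
    rw [hD]
    linear_combination (nullCoord i x - nullCoord i b) * hc x h3
      - (nullCoord i x - nullCoord i c) * hb x h1
  · intro x hx y hy h
    obtain ⟨-, h1, -⟩ := Finset.mem_filter.1 (Finset.mem_coe.1 hx)
    obtain ⟨-, h1', -⟩ := Finset.mem_filter.1 (Finset.mem_coe.1 hy)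
    refine nullCoord_ext hi h2 h ?_
    have h3 := hb x h1
    have h4 := hb y h1'
    have h0 : nullCoord i x - nullCoord i b ≠ 0 := left_ne_zero_of_mul (h3.trans_ne hρ)
    apply mul_left_cancel₀ h0
    rw [← h] at h4
    linear_combination h3 - h4

open Classical in
lemma card_pairsAt_eq_sum (A : Finset (F × F)) (r : F) :
    (pairsAt A r).card = ∑ a ∈ A, (A.filter fun b => dist2 a b = r).card := by
  rw [← Finset.card_sigma]
  refine Finset.card_bij' (fun q _ => ⟨q.1, q.2⟩) (fun s _ => (s.1, s.2)) ?_ ?_ ?_ ?_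
  · intro q hq
    rw [mem_pairsAt] at hq
    simp [hq]
  · intro q hq
    rw [mem_pairsAt]
    simp at hq
    tauto
  · intros; rfl
  · intros; rfl

lemma card_pairsAt_sq_le {i : E} (hi : i ^ 2 = -1) (h2 : (2 : F) ≠ 0) (hr : r ≠ 0)
    (A : Finset (F × F)) :
    (pairsAt A r).card ^ 2 ≤ A.card * ((pairsAt A r).card + 2 * A.card ^ 2) := by
  classical
  conv_lhs => rw [card_pairsAt_eq_sum]
  refine sq_sum_le_card_mul_sum_sq.trans (Nat.mul_le_mul_left _ ?_)
  have h1 : ∀ a ∈ A, (A.filter fun b => dist2 a b = r).card ^ 2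
      = ((A ×ˢ A).bipartiteAbove (fun a q => dist2 a q.1 = r ∧ dist2 a q.2 = r) a).card := by
    intro a _
    rw [sq, ← Finset.card_product, ← Finset.filter_product]
    rfl
  rw [Finset.sum_congr rfl h1, Finset.sum_card_bipartiteAbove_eq_sum_card_bipartiteBelow,
    Finset.sum_product]
  have h3 : ∀ b ∈ A, ∑ c ∈ A, (A.bipartiteBelow
      (fun a (q : (F × F) × (F × F)) => dist2 a q.1 = r ∧ dist2 a q.2 = r) (b, c)).card
      ≤ (A.filter fun c => dist2 b c = r).card + 2 * A.card := by
    intro b hb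
    rw [← Finset.add_sum_erase _ _ hb]
    refine add_le_add (Finset.card_le_card fun x hx => ?_) ?_
    · simp only [Finset.bipartiteBelow, Finset.mem_filter] at hx ⊢
      exact ⟨hx.1, (dist2_comm b x).trans hx.2.1⟩
    · refine (Finset.sum_le_card_nsmul _ _ 2 fun c hc => ?_).trans ?_
      · refine (card_two_circles_le A hi h2 hr (Finset.ne_of_mem_erase hc).symm).trans' ?_
        exact Finset.card_le_card fun x hx => by simpa [Finset.bipartiteBelow] using hx
      · rw [smul_eq_mul, mul_comm]
        exact Nat.mul_le_mul_left _ (Finset.card_erase_le)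
  refine (Finset.sum_le_sum h3).trans ?_
  rw [Finset.sum_add_distrib, ← card_pairsAt_eq_sum, Finset.sum_const, smul_eq_mul]
  apply le_of_eq; ring

lemma card_pairsAt_le {i : E} (hi : i ^ 2 = -1) (h2 : (2 : F) ≠ 0) (hr : r ≠ 0)
    (A : Finset (F × F)) {p : ℕ} (hp : 0 < p) (hA : A.card ^ 3 ≤ p ^ 4) :
    (pairsAt A r).card ≤ 3 * p ^ 2 := by
  have h := card_pairsAt_sq_le hi h2 hr A
  have hn : A.card ≤ p ^ 2 := by
    by_contra! hc
    have h3 : (p ^ 2) ^ 3 < A.card ^ 3 := Nat.pow_lt_pow_left hc (by norm_num)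
    have h4 : p ^ 4 ≤ (p ^ 2) ^ 3 := by
      rw [← pow_mul]; exact Nat.pow_le_pow_right hp (by norm_num)
    omega
  by_contra! hc
  have h5 : A.card * (pairsAt A r).card ≤ p ^ 2 * (pairsAt A r).card := Nat.mul_le_mul_right _ hn
  have hp2 : 0 < p ^ 2 := by positivity
  generalize (pairsAt A r).card = N at *
  generalize A.card = n at *
  have : p ^ 4 = p ^ 2 * p ^ 2 := by ring
  rw [this] at hA
  generalize p ^ 2 = s at *
  nlinarith

end CirclePairCount

section BisectorQuadruples

variable {F E : Type*} [Field F] [Field E] [Algebra F E] {A : Finset (F × F)} {M : ℕ} {r : F}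

lemma dot_sub_of_bisector_eq (h2 : (2 : F) ≠ 0) {a b c d : F × F}
    (h : bisector a c = bisector b d) :
    (b.1 - d.1) * (b.1 + d.1 - a.1 - c.1) + (b.2 - d.2) * (b.2 + d.2 - a.2 - c.2) = 0 ∧
    (b.1 - d.1) * (c.2 - a.2) - (b.2 - d.2) * (c.1 - a.1) = 0 := by
  obtain ⟨m, hm1, hm2⟩ : ∃ m : F × F, 2 * m.1 = a.1 + c.1 ∧ 2 * m.2 = a.2 + c.2 :=
    ⟨((a.1 + c.1) / 2, (a.2 + c.2) / 2), by field_simp, by field_simp⟩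
  have h1 : m ∈ bisector b d := by
    rw [← h, bisector, Set.mem_ofPred_eq, dist2, dist2]
    linear_combination (c.1 - a.1) * hm1 + (c.2 - a.2) * hm2
  have h3 : (m.1 - (c.2 - a.2), m.2 + (c.1 - a.1)) ∈ bisector b d := by
    rw [← h, bisector, Set.mem_ofPred_eq, dist2, dist2]
    linear_combination (c.1 - a.1) * hm1 + (c.2 - a.2) * hm2
  simp only [bisector, Set.mem_ofPred_eq, dist2] at h1 h3
  refine ⟨?_, mul_left_cancel₀ h2 ?_⟩
  · linear_combination h1 + (b.1 - d.1) * hm1 + (b.2 - d.2) * hm2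
  · linear_combination h3 - h1

lemma dist2_eq_of_bisector_eq (h2 : (2 : F) ≠ 0) {a b c d : F × F}
    (h : bisector a c = bisector b d) : dist2 a b = dist2 c d := by
  have h1 := (dot_sub_of_bisector_eq h2 h).1
  have h3 := (dot_sub_of_bisector_eq h2 h.symm).1
  rw [dist2, dist2]
  linear_combination h1 + h3

lemma nullCoord_rel_of_bisector_eq {i : E} (hi : i ^ 2 = -1) (h2 : (2 : F) ≠ 0) {a b c d : F × F}
    (h : bisector a c = bisector b d) :
    (nullCoord i c - nullCoord i d) * (nullCoord (-i) c - nullCoord (-i) a)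
      + (nullCoord (-i) a - nullCoord (-i) b) * (nullCoord i c - nullCoord i a) = 0 := by
  have h1 := congrArg (algebraMap F E) (dot_sub_of_bisector_eq h2 h).2
  have h3 := congrArg (algebraMap F E) (dot_sub_of_bisector_eq h2 h.symm).1
  simp only [map_add, map_sub, map_mul, map_zero] at h1 h3
  simp only [nullCoord]
  linear_combination -h3 - i * h1 - (algebraMap F E a.2 + algebraMap F E c.2 - algebraMap F E b.2
    - algebraMap F E d.2) * (algebraMap F E c.2 - algebraMap F E a.2) * hi

lemma eq_of_bisector_eq (h2 : (2 : F) ≠ 0) {a b c d d' : F × F} (hac : dot (a - c) (a - c) ≠ 0)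
    (h : bisector a c = bisector b d) (h' : bisector a c = bisector b d') : d = d' := by
  have h1 := (dot_sub_of_bisector_eq h2 h).2
  have h3 := (dot_sub_of_bisector_eq h2 h.symm).1
  have h1' := (dot_sub_of_bisector_eq h2 h').2
  have h3' := (dot_sub_of_bisector_eq h2 h'.symm).1
  simp only [dot, Prod.fst_sub, Prod.snd_sub] at hac
  refine Prod.ext (mul_left_cancel₀ hac ?_) (mul_left_cancel₀ hac ?_)
  · linear_combination -(a.1 - c.1) * (h3 - h3') + (a.2 - c.2) * (h1 - h1')
  · linear_combination -(a.2 - c.2) * (h3 - h3') - (a.1 - c.1) * (h1 - h1')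

open Classical in
/-- The pairs of points of `A` that have a perpendicular bisector. -/
noncomputable def bisectorPairs (A : Finset (F × F)) : Finset ((F × F) × (F × F)) :=
  (A ×ˢ A).filter fun q => q.1 ≠ q.2 ∧ dot (q.1 - q.2) (q.1 - q.2) ≠ 0

open Classical in
/-- The pairs of pairs of points of `A` with the same perpendicular bisector. -/
noncomputable def bisectorQuads (A : Finset (F × F)) :
    Finset (((F × F) × (F × F)) × ((F × F) × (F × F))) :=
  (bisectorPairs A ×ˢ bisectorPairs A).filter fun q =>
    bisector q.1.1 q.1.2 = bisector q.2.1 q.2.2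

lemma mem_bisectorPairs {q : (F × F) × (F × F)} : q ∈ bisectorPairs A ↔
    (q.1 ∈ A ∧ q.2 ∈ A) ∧ q.1 ≠ q.2 ∧ dot (q.1 - q.2) (q.1 - q.2) ≠ 0 := by
  classical
  simp only [bisectorPairs, Finset.mem_filter, Finset.mem_product]

lemma mem_bisectorQuads {q : ((F × F) × (F × F)) × ((F × F) × (F × F))} :
    q ∈ bisectorQuads A ↔ (q.1 ∈ bisectorPairs A ∧ q.2 ∈ bisectorPairs A) ∧
      bisector q.1.1 q.1.2 = bisector q.2.1 q.2.2 := by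
  classical
  simp only [bisectorQuads, Finset.mem_filter, Finset.mem_product]

lemma card_bisectorQuads_le (A : Finset (F × F)) : (bisectorQuads A).card ≤ A.card ^ 4 := by
  classical
  refine (Finset.card_filter_le _ _).trans ?_
  rw [Finset.card_product]
  have h : (bisectorPairs A).card ≤ A.card * A.card :=
    (Finset.card_filter_le _ _).trans (Finset.card_product _ _).le
  exact (Nat.mul_le_mul h h).trans (by apply le_of_eq; ring)

lemma bstar_le (A : Finset (F × F)) : Bstar A ≤ (bisectorQuads A).card := by
  classical
  have hb : ∀ ℓ, bstarL A ℓ = ((bisectorPairs A).filter fun q => bisector q.1 q.2 = ℓ).card := by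
    intro ℓ
    rw [bstarL, ← Set.ncard_coe_finset]
    congr 1
    ext q
    rw [Finset.mem_coe, Finset.mem_filter, mem_bisectorPairs, Set.mem_ofPred_eq]
    tauto
  rw [Bstar, finsum_mem_eq_sum_of_subset (t := ((bisectorPairs A).image fun q =>
    bisector q.1 q.2).filter IsLine)]
  · refine (Finset.sum_le_sum_of_subset (Finset.filter_subset _ _)).trans ?_
    rw [Finset.card_eq_sum_card_fiberwise (f := fun q => bisector q.1.1 q.1.2)
      (t := (bisectorPairs A).image fun q => bisector q.1 q.2)]
    · refine Finset.sum_le_sum fun ℓ _ => ?_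
      rw [hb, sq, ← Finset.card_product]
      refine Finset.card_le_card fun q hq => ?_
      rw [Finset.mem_product, Finset.mem_filter, Finset.mem_filter] at hq
      rw [Finset.mem_filter, mem_bisectorQuads]
      exact ⟨⟨⟨hq.1.1, hq.2.1⟩, hq.1.2.trans hq.2.2.symm⟩, hq.1.2⟩
    · intro q hq
      exact Finset.mem_image_of_mem (fun q : (F × F) × (F × F) => bisector q.1 q.2)
        (mem_bisectorQuads.1 hq).1.1
  · rintro ℓ ⟨hℓ, h0⟩
    rw [Finset.mem_coe, Finset.mem_filter]
    refine ⟨?_, hℓ⟩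
    by_contra hc
    apply h0
    simp only [hb]
    rw [Finset.filter_eq_empty_iff.2, Finset.card_empty, zero_pow two_ne_zero]
    intro q hq h
    exact hc (h ▸ Finset.mem_image_of_mem (fun q : (F × F) × (F × F) => bisector q.1 q.2) hq)
  · intro ℓ hℓ
    exact (Finset.mem_filter.1 (Finset.mem_coe.1 hℓ)).2

open Classical in
lemma AtMostOnCurves.card_isotropic_quads_le (hA : AtMostOnCurves A M) {i : E} (hi : i ^ 2 = -1)
    (h2 : (2 : F) ≠ 0) :
    ((bisectorQuads A).filter fun q => dist2 q.1.1 q.2.1 = 0).card ≤ 2 * M * A.card ^ 2 := by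
  rw [sq, ← Finset.card_product]
  refine Finset.card_le_mul_card_image_of_maps_to (f := Prod.fst) (fun q hq => ?_) (2 * M)
    fun s hs => ?_
  · exact Finset.mem_product.2
      (mem_bisectorPairs.1 (mem_bisectorQuads.1 (Finset.mem_filter.1 hq).1).1.1).1
  · refine le_trans ?_ (hA.card_circle_le hi h2 s.1 0)
    refine Finset.card_le_card_of_injOn (fun q => q.2.1) ?_ ?_
    · intro q hq
      obtain ⟨hqs, rfl⟩ := Finset.mem_filter.1 (Finset.mem_coe.1 hq)
      obtain ⟨hqA, h⟩ := Finset.mem_filter.1 hqs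
      rw [Finset.mem_coe, Finset.mem_filter]
      exact ⟨(mem_bisectorPairs.1 (mem_bisectorQuads.1 hqA).1.2).1.1, (dist2_comm _ _).trans h⟩
    · intro q hq q' hq' h
      obtain ⟨hq, h1⟩ := Finset.mem_filter.1 (Finset.mem_coe.1 hq)
      obtain ⟨hq', h1'⟩ := Finset.mem_filter.1 (Finset.mem_coe.1 hq')
      have h3 := mem_bisectorQuads.1 (Finset.mem_filter.1 hq).1
      have h3' := mem_bisectorQuads.1 (Finset.mem_filter.1 hq').1
      refine Prod.ext (h1.trans h1'.symm) (Prod.ext h ?_)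
      refine eq_of_bisector_eq h2 (mem_bisectorPairs.1 h3.1.1).2.2 h3.2 ?_
      have h4 : q.2.1 = q'.2.1 := h
      rw [h4, h1, ← h1']
      exact h3'.2

open Classical in
lemma AtMostOnCurves.card_quads_le [Infinite E] (hA : AtMostOnCurves A M) {i : E}
    (hi : i ^ 2 = -1) (h2 : (2 : F) ≠ 0) (hr : r ≠ 0) {p : ℕ} (hp : 30 ≤ p)
    (hchar : ∀ j : ℕ, 0 < j → j < p → (j : F) ≠ 0) (hAp : A.card ^ 3 ≤ p ^ 4) :
    ((bisectorQuads A).filter fun q => dist2 q.1.1 q.2.1 = r).card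
      ≤ 16000000 * (2 * (pairsAt A r).card
        * (15 * Nat.sqrt (12 * (pairsAt A r).card) + 2 * M)) := by
  refine le_trans ?_ (hA.card_related_pairs_le hi h2 hr hp hchar
    (card_pairsAt_le hi h2 hr A (by omega) hAp))
  refine Finset.card_le_card_of_injOn (fun q => ((q.1.1, q.2.1), (q.1.2, q.2.2))) ?_ ?_
  · intro q hq
    obtain ⟨hq, h⟩ := Finset.mem_filter.1 (Finset.mem_coe.1 hq)
    obtain ⟨⟨h1, h3⟩, h4⟩ := mem_bisectorQuads.1 hq
    have h1 := (mem_bisectorPairs.1 h1).1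
    have h3 := (mem_bisectorPairs.1 h3).1
    rw [Finset.mem_coe, Finset.mem_filter, Finset.mem_product, mem_pairsAt, mem_pairsAt]
    exact ⟨⟨⟨⟨h1.1, h3.1⟩, h⟩, ⟨h1.2, h3.2⟩, (dist2_eq_of_bisector_eq h2 h4).symm.trans h⟩,
      nullCoord_rel_of_bisector_eq hi h2 h4⟩
  · intro q _ q' _ h
    simp only [Prod.mk.injEq] at h
    exact Prod.ext (Prod.ext h.1.1 h.2.1) (Prod.ext h.1.2 h.2.2)

end BisectorQuadruples

section EnergyBound

variable {F E : Type*} [Field F] [Field E] [Algebra F E] {A : Finset (F × F)} {M : ℕ}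

lemma ncard_Sr_eq {r : F} (hr : r ≠ 0) (A : Finset (F × F)) :
    (Sr A r).ncard = (pairsAt A r).card := by
  rw [← Set.ncard_coe_finset]
  congr 1
  ext q
  rw [Finset.mem_coe, mem_pairsAt, Sr, Set.mem_ofPred_eq]
  refine ⟨fun h => ⟨⟨h.1, h.2.1⟩, h.2.2.2⟩, fun h => ⟨h.1.1, h.1.2, fun h0 => hr ?_, h.2⟩⟩
  rw [← h.2, h0, dist2]; ring

open Classical in
/-- The nonzero distances determined by `A`. -/
noncomputable def nonzeroDistances (A : Finset (F × F)) : Finset F :=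
  ((A ×ˢ A).image fun q => dist2 q.1 q.2).erase 0

lemma sum_card_pairsAt_le (A : Finset (F × F)) :
    ∑ r ∈ nonzeroDistances A, (pairsAt A r).card ≤ A.card ^ 2 := by
  classical
  rw [sq, ← Finset.card_product, Finset.card_eq_sum_card_image (fun q => dist2 q.1 q.2) (A ×ˢ A)]
  refine (Finset.sum_le_sum_of_subset (Finset.erase_subset _ _)).trans (le_of_eq ?_)
  refine Finset.sum_congr rfl fun r _ => congrArg Finset.card (Finset.ext fun q => ?_)
  rw [mem_pairsAt, Finset.mem_filter, Finset.mem_product]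

lemma finsum_ncard_Sr_rpow (A : Finset (F × F)) :
    ∑ᶠ r ∈ {r : F | r ≠ 0}, ((Sr A r).ncard : ℝ) ^ ((3 : ℝ) / 2)
      = ∑ r ∈ nonzeroDistances A, ((pairsAt A r).card : ℝ) ^ ((3 : ℝ) / 2) := by
  classical
  rw [finsum_mem_eq_sum_of_subset (t := nonzeroDistances A)]
  · refine Finset.sum_congr rfl fun r hr => ?_
    rw [ncard_Sr_eq (Finset.ne_of_mem_erase hr)]
  · rintro r ⟨hr, h0⟩
    rw [Function.mem_support, ncard_Sr_eq hr] at h0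
    have : (pairsAt A r).card ≠ 0 := by
      intro h; apply h0; rw [h, Nat.cast_zero, Real.zero_rpow (by norm_num)]
    obtain ⟨q, hq⟩ := Finset.card_ne_zero.1 this
    rw [mem_pairsAt] at hq
    exact Finset.mem_erase.2 ⟨hr, Finset.mem_image.2 ⟨q, Finset.mem_product.2 hq.1, hq.2⟩⟩
  · exact fun r hr => Finset.ne_of_mem_erase hr

open Classical in
lemma bisectorQuads_card_eq_sum (A : Finset (F × F)) :
    (bisectorQuads A).card = ((bisectorQuads A).filter fun q => dist2 q.1.1 q.2.1 = 0).card
      + ∑ r ∈ nonzeroDistances A,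
        ((bisectorQuads A).filter fun q => dist2 q.1.1 q.2.1 = r).card := by
  rw [← Finset.sum_insert (f := fun r =>
    ((bisectorQuads A).filter fun q => dist2 q.1.1 q.2.1 = r).card)]
  · refine Finset.card_eq_sum_card_fiberwise fun q hq => ?_
    obtain ⟨h1, h3⟩ := (mem_bisectorQuads.1 hq).1
    rw [Finset.mem_coe, Finset.mem_insert]
    by_cases h0 : dist2 q.1.1 q.2.1 = 0
    · exact Or.inl h0
    · refine Or.inr (Finset.mem_erase.2 ⟨h0, Finset.mem_image.2 ⟨(q.1.1, q.2.1), ?_, rfl⟩⟩)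
      exact Finset.mem_product.2 ⟨(mem_bisectorPairs.1 h1).1.1, (mem_bisectorPairs.1 h3).1.1⟩
  · exact Finset.notMem_erase _ _

lemma natSqrt_bound_le_rpow (N M : ℕ) :
    ((16000000 * (2 * N * (15 * Nat.sqrt (12 * N) + 2 * M)) : ℕ) : ℝ)
      ≤ 2000000000 * ((N : ℝ) ^ ((3 : ℝ) / 2) + M * N) := by
  have hN : (0 : ℝ) ≤ N := N.cast_nonneg
  have h1 : (N : ℝ) ^ ((3 : ℝ) / 2) = N * Real.sqrt N := by
    rw [Real.sqrt_eq_rpow, ← Real.rpow_one_add' hN (by norm_num)]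
    norm_num
  have h3 : (Nat.sqrt (12 * N) : ℝ) ≤ 4 * Real.sqrt N := by
    refine Real.nat_sqrt_le_real_sqrt.trans ?_
    rw [Real.sqrt_le_left (by positivity), mul_pow, Real.sq_sqrt hN]
    push_cast; linarith
  rw [h1]
  push_cast
  have h4 := mul_le_mul_of_nonneg_left h3 hN
  have h5 : (0 : ℝ) ≤ N * Real.sqrt N := by positivity
  have h6 : (0 : ℝ) ≤ M * N := by positivity
  nlinarith

lemma AtMostOnCurves.bstar_le_of_char [Infinite E] (hA : AtMostOnCurves A M) {i : E}
    (hi : i ^ 2 = -1) {p : ℕ} (hp : 30 ≤ p)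
    (hchar : ∀ j : ℕ, 0 < j → j < p → (j : F) ≠ 0) (hAp : A.card ^ 3 ≤ p ^ 4) :
    (Bstar A : ℝ) ≤ 3000000000 * ((M : ℝ) * (A.card : ℝ) ^ 2 +
      ∑ᶠ r ∈ {r : F | r ≠ 0}, ((Sr A r).ncard : ℝ) ^ ((3 : ℝ) / 2)) := by
  classical
  have h2 : (2 : F) ≠ 0 := by exact_mod_cast hchar 2 (by norm_num) (by omega)
  have h1 : (Bstar A : ℝ) ≤ (bisectorQuads A).card := by exact_mod_cast bstar_le A
  have h3 : (((bisectorQuads A).filter fun q => dist2 q.1.1 q.2.1 = 0).card : ℝ)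
      ≤ 2 * M * (A.card : ℝ) ^ 2 := by
    have := hA.card_isotropic_quads_le hi h2
    exact_mod_cast this
  have h4 : ∑ r ∈ nonzeroDistances A,
      (((bisectorQuads A).filter fun q => dist2 q.1.1 q.2.1 = r).card : ℝ)
      ≤ ∑ r ∈ nonzeroDistances A, 2000000000 * (((pairsAt A r).card : ℝ) ^ ((3 : ℝ) / 2)
        + M * (pairsAt A r).card) := by
    refine Finset.sum_le_sum fun r hr => (natSqrt_bound_le_rpow _ M).trans' ?_
    exact Nat.cast_le.2 (hA.card_quads_le hi h2 (Finset.ne_of_mem_erase hr) hp hchar hAp)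
  rw [← Finset.mul_sum, Finset.sum_add_distrib, ← Finset.mul_sum] at h4
  have h5 : (∑ r ∈ nonzeroDistances A, ((pairsAt A r).card : ℝ)) ≤ (A.card : ℝ) ^ 2 := by
    exact_mod_cast sum_card_pairsAt_le A
  have h6 := mul_le_mul_of_nonneg_left h5 (Nat.cast_nonneg (α := ℝ) M)
  have h7 := congrArg (Nat.cast (R := ℝ)) (bisectorQuads_card_eq_sum A)
  push_cast at h7
  have h8 : 0 ≤ ∑ r ∈ nonzeroDistances A, ((pairsAt A r).card : ℝ) ^ ((3 : ℝ) / 2) :=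
    Finset.sum_nonneg fun r _ => by positivity
  have h9 : 0 ≤ (M : ℝ) * (A.card : ℝ) ^ 2 := by positivity
  rw [finsum_ncard_Sr_rpow]
  linarith

open Classical in
lemma AtMostOnCurves.bstar_le_of_card (hA : AtMostOnCurves A M) (hAc : A.card ≤ 100) :
    Bstar A ≤ 10000 * (M * A.card ^ 2) := by
  refine (bstar_le A).trans ((card_bisectorQuads_le A).trans ?_)
  rcases A.eq_empty_or_nonempty with rfl | ⟨x, hx⟩
  · simp
  · have h1 : 1 ≤ M := by
      refine le_trans ?_ (hA.card_filter_le (p := fun y => y = x)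
        (Or.inl ⟨x, (1, 0), by simp, rfl⟩) fun y hy => ⟨0, by rw [hy]; simp⟩)
      exact Finset.card_pos.2 ⟨x, by simp [hx]⟩
    calc A.card ^ 4 = A.card ^ 2 * A.card ^ 2 := by ring
      _ ≤ 100 ^ 2 * (M * A.card ^ 2) := Nat.mul_le_mul (Nat.pow_le_pow_left hAc 2)
          (Nat.le_mul_of_pos_left _ h1)
      _ = 10000 * (M * A.card ^ 2) := by norm_num

lemma pow_three_le_of_le_rpow {n p : ℕ} (h : (n : ℝ) ≤ (p : ℝ) ^ ((4 : ℝ) / 3)) :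
    n ^ 3 ≤ p ^ 4 := by
  have h1 : (n : ℝ) ^ 3 ≤ ((p : ℝ) ^ ((4 : ℝ) / 3)) ^ 3 := by gcongr
  rw [← Real.rpow_natCast ((p : ℝ) ^ ((4 : ℝ) / 3)) 3, ← Real.rpow_mul p.cast_nonneg] at h1
  norm_num at h1
  exact_mod_cast h1

lemma card_le_or_exists_char (F : Type*) [Field F] (n : ℕ)
    (h : ∀ p : ℕ, p ≠ 0 → CharP F p → (n : ℝ) ≤ (p : ℝ) ^ ((4 : ℝ) / 3)) :
    n ≤ 100 ∨ ∃ p : ℕ, 30 ≤ p ∧ (∀ j : ℕ, 0 < j → j < p → (j : F) ≠ 0) ∧ n ^ 3 ≤ p ^ 4 := by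
  obtain ⟨p, hp⟩ := CharP.exists F
  rcases eq_or_ne p 0 with rfl | hp0
  · refine Or.inr ⟨max 30 n, le_max_left _ _, fun j hj _ h0 => ?_, ?_⟩
    · rw [CharP.cast_eq_zero_iff F 0, zero_dvd_iff] at h0
      omega
    · exact (Nat.pow_le_pow_left (le_max_right 30 n) 3).trans
        (Nat.pow_le_pow_right (by positivity) (by norm_num))
  · have h1 := pow_three_le_of_le_rpow (h p hp0 hp)
    rcases lt_or_ge p 30 with h3 | h3
    · left
      by_contra! hc
      have h4 : p ^ 4 ≤ 30 ^ 4 := Nat.pow_le_pow_left h3.le 4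
      have h5 : 100 ^ 3 ≤ n ^ 3 := Nat.pow_le_pow_left hc.le 3
      norm_num at h4 h5
      omega
    · refine Or.inr ⟨p, h3, fun j hj hjp h0 => ?_, h1⟩
      rw [CharP.cast_eq_zero_iff F p] at h0
      exact absurd (Nat.le_of_dvd hj h0) (by omega)

end EnergyBound

/-- Bisector energy bound: there is an absolute constant `C > 0` such that for every field `F`,
every finite `A ⊆ F²` (with `|A| ≤ p^(4/3)` if `char F = p > 0`), if at most `M` points of `A`
lie on a common line or a common circle, then
`B*(A) ≤ C·(M|A|² + Σ_{r ≠ 0} |S_r(A)|^(3/2))`. -/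
theorem bisector_energy_bound :
    ∃ C : ℝ, 0 < C ∧
      ∀ (F : Type) [inst : Field F],
        ∀ (A : Finset (F × F)) (M : ℕ),
          (∀ p : ℕ, p ≠ 0 → CharP F p → (A.card : ℝ) ≤ (p : ℝ) ^ ((4 : ℝ) / 3)) →
          (∀ L : Set (F × F), IsLine L ∨ IsCircle L → ((A : Set (F × F)) ∩ L).ncard ≤ M) →
          (Bstar A : ℝ) ≤
            C * ((M : ℝ) * (A.card : ℝ) ^ 2 +
              ∑ᶠ r ∈ {r : F | r ≠ 0}, ((Sr A r).ncard : ℝ) ^ ((3 : ℝ) / 2)) := by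
  refine ⟨3000000000, by norm_num, fun F _ A M hp hA => ?_⟩
  rcases card_le_or_exists_char F A.card hp with h | ⟨p, h30, hchar, hAp⟩
  · have h1 : (Bstar A : ℝ) ≤ 10000 * ((M : ℝ) * (A.card : ℝ) ^ 2) := by
      exact_mod_cast AtMostOnCurves.bstar_le_of_card hA h
    have h3 : (0 : ℝ) ≤ (M : ℝ) * (A.card : ℝ) ^ 2 := by positivity
    have h4 : 0 ≤ ∑ᶠ r ∈ {r : F | r ≠ 0}, ((Sr A r).ncard : ℝ) ^ ((3 : ℝ) / 2) :=
      finsum_nonneg fun r => finsum_nonneg fun _ => by positivity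
    linarith
  · obtain ⟨i, hi⟩ := IsAlgClosed.exists_pow_nat_eq (-1 : AlgebraicClosure F) two_pos
    exact AtMostOnCurves.bstar_le_of_char hA hi h30 hchar hAp

end Stmt7
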